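/- Let (E₁,…,Eₙ) be a complete exceptional sequence over a hereditary algebra Λ. Then Eₖ is both relatively projective and relatively injective if and only if the support of Eₖ is not contained in the union of the supports of the other terms E_j, j ≠ k. -/

import Mathlib

open CategoryTheory

universe u

variable {A : Type u} [Ring A]

namespace ExcSeq

/-- `Hom(X, Y) = 0`. -/
def homZero (X Y : ModuleCat.{u} A) : Prop := ∀ f : X ⟶ Y, f = 0

/-- `Ext¹(X, Y) = 0`: every short exact sequence `0 → Y → E → X → 0` splits. -/
def extZero (X Y : ModuleCat.{u} A) : Prop :=
  ∀ (E : ModuleCat.{u} A) (i : Y ⟶ E) (p : E ⟶ X) (w : i ≫ p = 0),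
    (ShortComplex.mk i p w).ShortExact → ∃ s : X ⟶ E, s ≫ p = 𝟙 X

/-- `Y` belongs to the right perpendicular category `X^⊥`. -/
def rperp (X Y : ModuleCat.{u} A) : Prop := homZero X Y ∧ extZero X Y

/-- `Y` belongs to the left perpendicular category `^⊥X`. -/
def lperp (X Y : ModuleCat.{u} A) : Prop := homZero Y X ∧ extZero Y X

/-- An exceptional module: finitely generated, rigid, with division algebra endomorphism
ring (in particular nonzero and indecomposable). -/
def ExceptionalMod (X : ModuleCat.{u} A) : Prop :=
  Module.Finite A X ∧ extZero X X ∧ Nontrivial X ∧ ∀ f : X ⟶ X, f ≠ 0 → IsIso f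

/-- An exceptional sequence `(E 0, …, E (n-1))`. -/
def IsExcSeq {n : ℕ} (E : Fin n → ModuleCat.{u} A) : Prop :=
  (∀ i, ExceptionalMod (E i)) ∧ ∀ i j : Fin n, i < j → rperp (E j) (E i)

/-- A complete exceptional sequence: an exceptional sequence of maximal length. -/
def CompleteES {n : ℕ} (E : Fin n → ModuleCat.{u} A) : Prop :=
  IsExcSeq E ∧ ∀ (m : ℕ) (F : Fin m → ModuleCat.{u} A), IsExcSeq F → m ≤ n

/-- The wide subcategory `𝒜ₖ = (E_{k+1} ⊕ ⋯ ⊕ Eₙ)^⊥`. -/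
def Aperp {n : ℕ} (E : Fin n → ModuleCat.{u} A) (k : Fin n) (X : ModuleCat.{u} A) : Prop :=
  ∀ j : Fin n, k < j → rperp (E j) X

/-- The wide subcategory `ℬₖ = ^⊥(E₁ ⊕ ⋯ ⊕ E_{k-1})`. -/
def Bperp {n : ℕ} (E : Fin n → ModuleCat.{u} A) (k : Fin n) (X : ModuleCat.{u} A) : Prop :=
  ∀ j : Fin n, j < k → lperp (E j) X

/-- `X` is a projective object of the subcategory (given by the predicate) `C`. -/
def ProjIn (C : ModuleCat.{u} A → Prop) (X : ModuleCat.{u} A) : Prop :=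
  C X ∧ ∀ (Y Z : ModuleCat.{u} A), C Y → C Z → ∀ p : Y ⟶ Z, Epi p →
    ∀ f : X ⟶ Z, ∃ g : X ⟶ Y, g ≫ p = f

/-- `X` is an injective object of the subcategory (given by the predicate) `C`. -/
def InjIn (C : ModuleCat.{u} A → Prop) (X : ModuleCat.{u} A) : Prop :=
  C X ∧ ∀ (Y Z : ModuleCat.{u} A), C Y → C Z → ∀ i : Y ⟶ Z, Mono i →
    ∀ f : Y ⟶ X, ∃ g : Z ⟶ X, i ≫ g = f

/-- `E k` is relatively projective in the exceptional sequence `E`. -/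
def RelProj {n : ℕ} (E : Fin n → ModuleCat.{u} A) (k : Fin n) : Prop :=
  ProjIn (Aperp E k) (E k)

/-- `E k` is relatively injective in the exceptional sequence `E`. -/
def RelInj {n : ℕ} (E : Fin n → ModuleCat.{u} A) (k : Fin n) : Prop :=
  InjIn (Bperp E k) (E k)

/-- `Λ` is hereditary: every submodule of a projective module is projective. -/
def Hereditary (A : Type u) [Ring A] : Prop :=
  ∀ (P : ModuleCat.{u} A), Projective P →
    ∀ S : Submodule A P, Projective (ModuleCat.of A S)

/-- The simple module `S` is in the support of `M`, i.e. `S` is (isomorphic to) a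
composition factor (subquotient) of `M`. -/
def InSupport (S M : ModuleCat.{u} A) : Prop :=
  ∃ (N₁ N₂ : Submodule A M), N₁ ≤ N₂ ∧
    Nonempty ((ModuleCat.of A (N₂ ⧸ (Submodule.comap N₂.subtype N₁))) ≅ S)



section E0theory

variable {X Y Z W N P R X' : Type u} [AddCommGroup X] [Module A X] [AddCommGroup Y] [Module A Y]
  [AddCommGroup Z] [Module A Z] [AddCommGroup W] [Module A W] [AddCommGroup N] [Module A N]
  [AddCommGroup P] [Module A P] [AddCommGroup R] [Module A R] [AddCommGroup X'] [Module A X']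

/-- factor through a surjection -/
theorem fac (Φ : W →ₗ[A] X) (hΦ : Function.Surjective Φ) (Ψ : W →ₗ[A] Y)
    (h : ∀ w, Φ w = 0 → Ψ w = 0) : ∃ g : X →ₗ[A] Y, ∀ w, g (Φ w) = Ψ w := by
  have hk : LinearMap.ker Φ ≤ LinearMap.ker Ψ := fun w hw => h w hw
  refine ⟨(Submodule.liftQ _ Ψ hk).comp (Φ.quotKerEquivOfSurjective hΦ).symm.toLinearMap, ?_⟩
  intro w
  have : (Φ.quotKerEquivOfSurjective hΦ).symm (Φ w) = Submodule.Quotient.mk w := by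
    rw [LinearEquiv.symm_apply_eq]; rfl
  simp [this]

/-- factor through an injection -/
theorem facInj (i : N →ₗ[A] W) (hi : Function.Injective i) (f : X →ₗ[A] W)
    (h : ∀ x, ∃ n, i n = f x) : ∃ g : X →ₗ[A] N, ∀ x, i (g x) = f x := by
  have hk : ∀ x, f x ∈ LinearMap.range i := h
  refine ⟨(LinearEquiv.ofInjective i hi).symm.toLinearMap.comp (f.codRestrict _ hk), ?_⟩
  intro x
  have := (LinearEquiv.ofInjective i hi).apply_symm_apply (f.codRestrict _ hk x)
  simpa [LinearEquiv.ofInjective_apply] using congrArg Subtype.val this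

/-- Vanishing of `Ext¹`, extension form. -/
def E0 (A : Type u) [Ring A] (X Y : Type u) [AddCommGroup X] [Module A X] [AddCommGroup Y]
    [Module A Y] : Prop :=
  ∀ (N W : Type u) [AddCommGroup N] [Module A N] [AddCommGroup W] [Module A W]
    (i : N →ₗ[A] W) (p : W →ₗ[A] X), Function.Injective i → Function.Surjective p →
    Function.Exact i p → ∀ f : N →ₗ[A] Y, ∃ g : W →ₗ[A] Y, ∀ x, g (i x) = f x

theorem E0.of_proj [Module.Projective A P] (i : R →ₗ[A] P) (p : P →ₗ[A] X)
    (hp : Function.Surjective p) (hip : Function.Exact i p)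
    (h : ∀ f : R →ₗ[A] Y, ∃ g : P →ₗ[A] Y, ∀ x, g (i x) = f x) : E0 A X Y := by
  intro N W _ _ _ _ j q hj hq hjq f
  obtain ⟨t, ht⟩ := Module.projective_lifting_property q p hq
  have ht' : ∀ x, q (t x) = p x := fun x => LinearMap.congr_fun ht x
  obtain ⟨t', ht2⟩ := facInj j hj (t.comp i) (fun x => by
    apply (hjq _).1
    simp only [LinearMap.comp_apply, ht']
    exact (hip _).2 ⟨x, rfl⟩)
  obtain ⟨g, hg⟩ := h (f.comp t')
  obtain ⟨k, hk⟩ := fac (LinearMap.coprod t j) (by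
    intro w
    obtain ⟨x, hx⟩ := hp (q w)
    obtain ⟨u, hu⟩ := (hjq (w - t x)).1 (by rw [map_sub, ht', hx, sub_self])
    exact ⟨(x, u), by simp [hu]⟩) (LinearMap.coprod g f) (by
    rintro ⟨x, u⟩ hxu
    simp only [LinearMap.coprod_apply] at hxu ⊢
    have h1 : p x = 0 := by
      have := congrArg q hxu
      rw [map_add, ht', (hjq (j u)).2 ⟨u, rfl⟩] at this
      simpa using this
    obtain ⟨y, rfl⟩ := (hip x).1 h1
    have h2 : t' y = - u := by
      apply hj
      rw [ht2, map_neg]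
      exact eq_neg_of_add_eq_zero_left hxu
    rw [hg]
    simp [h2])
  refine ⟨k, fun x => ?_⟩
  simpa using hk (0, x)

theorem E0.proj [Module.Projective A P] : E0 A P Y := by
  refine E0.of_proj (R := PUnit.{u+1}) (0 : PUnit.{u+1} →ₗ[A] P) (LinearMap.id) (fun x => ⟨x, rfl⟩) ?_ ?_
  · intro x; constructor
    · rintro h; exact ⟨0, h.symm⟩
    · rintro ⟨y, rfl⟩; rfl
  · intro f; exact ⟨0, fun x => by rw [Subsingleton.elim x 0, map_zero, map_zero, map_zero]⟩

theorem exact_ker (p : W →ₗ[A] X) : Function.Exact (LinearMap.ker p).subtype p := by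
  intro x; simp

theorem exact_sub (U : Submodule A W) : Function.Exact U.subtype U.mkQ := by
  intro x; simp

/-- free presentation -/
theorem exists_free (A : Type u) [Ring A] (X : Type u) [AddCommGroup X] [Module A X] :
    ∃ (P : ModuleCat.{u} A) (p : P →ₗ[A] X), Module.Projective A P ∧ Function.Surjective p := by
  refine ⟨ModuleCat.of A (X →₀ A), Finsupp.linearCombination A (id : X → X), ?_, ?_⟩
  · change Module.Projective A (X →₀ A); infer_instance
  · exact Finsupp.linearCombination_id_surjective A X

theorem E0.ext_first (h1 : E0 A N Y) (h2 : E0 A Z Y) (i : N →ₗ[A] W) (p : W →ₗ[A] Z)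
    (hi : Function.Injective i) (hp : Function.Surjective p) (hip : Function.Exact i p) :
    E0 A W Y := by
  intro R V _ _ _ _ j q hj hq hjq f
  let U : Submodule A V := LinearMap.ker (p.comp q)
  obtain ⟨q', hq'⟩ := facInj i hi (q.comp U.subtype) (fun x => (hip _).1 x.2)
  have hj' : ∀ x, j x ∈ U := fun x => by
    change p (q (j x)) = 0
    rw [(hjq (j x)).2 ⟨x, rfl⟩, map_zero]
  obtain ⟨g, hg⟩ := h1 R U (j.codRestrict U hj') q' (fun x y h => hj (congrArg Subtype.val h))
    (fun n => by
      obtain ⟨v, hv⟩ := hq (i n)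
      refine ⟨⟨v, ?_⟩, ?_⟩
      · change p (q v) = 0; rw [hv]; exact (hip _).2 ⟨n, rfl⟩
      · apply hi; rw [hq']; exact hv)
    (by
      intro x
      constructor
      · intro h
        have : q x.1 = 0 := by
          have := hq' x
          rw [h, map_zero] at this; exact this.symm
        obtain ⟨y, hy⟩ := (hjq _).1 this
        exact ⟨y, Subtype.ext hy⟩
      · rintro ⟨y, rfl⟩
        apply hi; rw [hq', map_zero]; exact (hjq _).2 ⟨y, rfl⟩) f
  obtain ⟨g', hg'⟩ := h2 U V U.subtype (p.comp q) Subtype.val_injective (hp.comp hq)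
    (exact_ker _) g
  exact ⟨g', fun x => by rw [← hg]; exact hg' ⟨j x, hj' x⟩⟩

theorem E0.lift (h : E0 A X N) (i : N →ₗ[A] W) (p : W →ₗ[A] Z)
    (hi : Function.Injective i) (hp : Function.Surjective p) (hip : Function.Exact i p)
    (g : X →ₗ[A] Z) : ∃ g' : X →ₗ[A] W, ∀ x, p (g' x) = g x := by
  let B : Submodule A (X × W) :=
    LinearMap.ker ((g.comp (LinearMap.fst A X W)) - p.comp (LinearMap.snd A X W))
  have hB : ∀ b : X × W, b ∈ B ↔ g b.1 = p b.2 := fun b => by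
    simp [B, sub_eq_zero]
  have hpi : ∀ n, p (i n) = 0 := fun n => (hip _).2 ⟨n, rfl⟩
  obtain ⟨r, hr⟩ := h N B (((LinearMap.inr A X W).comp i).codRestrict B (fun n => by
      rw [hB]; simp [hpi])) ((LinearMap.fst A X W).comp B.subtype)
    (fun x y hxy => hi (congrArg (fun b : B => b.1.2) hxy))
    (fun x => by
      obtain ⟨w, hw⟩ := hp (g x)
      exact ⟨⟨(x, w), (hB _).2 hw.symm⟩, rfl⟩)
    (by
      rintro ⟨⟨x, w⟩, hb⟩
      rw [hB] at hb
      constructor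
      · intro h
        change x = 0 at h
        subst h
        obtain ⟨n, hn⟩ := (hip w).1 (by simpa using hb.symm)
        exact ⟨n, Subtype.ext (by simp [hn])⟩
      · rintro ⟨n, hn⟩
        have := congrArg (fun b : B => b.1.1) hn
        simpa using this.symm) LinearMap.id
  obtain ⟨s, hs⟩ := fac ((LinearMap.fst A X W).comp B.subtype) (fun x => by
      obtain ⟨w, hw⟩ := hp (g x)
      exact ⟨⟨(x, w), (hB _).2 hw.symm⟩, rfl⟩)
    ((LinearMap.snd A X W).comp B.subtype - i.comp r) (by
      rintro ⟨⟨x, w⟩, hb⟩ h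
      have hb' := hb
      rw [hB] at hb'
      change x = 0 at h
      subst h
      obtain ⟨n, hn⟩ := (hip w).1 (by simpa using hb'.symm)
      subst hn
      have := hr n
      simp only [LinearMap.sub_apply, LinearMap.comp_apply]
      have e : r ⟨(0, i n), hb⟩ = n := this
      rw [e]; simp)
  refine ⟨s, fun x => ?_⟩
  obtain ⟨w, hw⟩ := hp (g x)
  have := hs ⟨(x, w), (hB _).2 hw.symm⟩
  change s x = w - i _ at this
  rw [this, map_sub, hpi, sub_zero, hw]

variable (A) in
/-- unbundled heredity -/
def Her : Prop := ∀ (P : Type u) [AddCommGroup P] [Module A P], Module.Projective A P →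
  ∀ S : Submodule A P, Module.Projective A S

theorem Hereditary.her (h : Hereditary A) : Her A := by
  intro P _ _ hP S
  exact (IsProjective.iff_projective S).2 (h (ModuleCat.of A P)
    ((IsProjective.iff_projective P).1 hP) S)

/-- hereditary: subobjects in the first variable -/
theorem E0.sub_first (hA : Her A) (h : E0 A W Y) (i : N →ₗ[A] W) (hi : Function.Injective i) :
    E0 A N Y := by
  obtain ⟨P, p, hP, hp⟩ := exists_free A W
  let U : Submodule A P := (LinearMap.range i).comap p
  have : Module.Projective A U := hA P hP U
  obtain ⟨q, hq⟩ := facInj i hi (p.comp U.subtype) (fun x => x.2)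
  have hk : ∀ x : LinearMap.ker p, x.1 ∈ U := fun x => by
    change p x.1 ∈ LinearMap.range i
    rw [x.2]; exact zero_mem _
  refine E0.of_proj ((LinearMap.ker p).subtype.codRestrict U hk) q ?_ ?_ ?_
  · intro n
    obtain ⟨x, hx⟩ := hp (i n)
    exact ⟨⟨x, ⟨n, hx.symm⟩⟩, hi (by rw [hq]; exact hx)⟩
  · intro x
    constructor
    · intro hx
      have := hq x
      rw [hx, map_zero] at this
      exact ⟨⟨x.1, this.symm⟩, rfl⟩
    · rintro ⟨y, rfl⟩
      apply hi; rw [hq, map_zero]; exact y.2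
  · intro f
    obtain ⟨g, hg⟩ := h _ P (LinearMap.ker p).subtype p Subtype.val_injective hp (exact_ker p) f
    exact ⟨g.comp U.subtype, fun x => hg x⟩

/-- quotients in the first variable -/
theorem E0.quot_first (h : E0 A W Y) (i : N →ₗ[A] W) (p : W →ₗ[A] Z)
    (hi : Function.Injective i) (hp : Function.Surjective p) (hip : Function.Exact i p)
    (hext : ∀ f : N →ₗ[A] Y, ∃ g : W →ₗ[A] Y, ∀ x, g (i x) = f x) : E0 A Z Y := by
  obtain ⟨P, q, hP, hq⟩ := exists_free A W
  let U : Submodule A P := LinearMap.ker (p.comp q)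
  refine E0.of_proj U.subtype (p.comp q) (hp.comp hq) (exact_ker _) ?_
  intro f
  have hk : ∀ x : LinearMap.ker q, x.1 ∈ U := fun x => by
    change p (q x.1) = 0
    rw [x.2, map_zero]
  let e : LinearMap.ker q →ₗ[A] U := (LinearMap.ker q).subtype.codRestrict U hk
  obtain ⟨g, hg⟩ := h _ P (LinearMap.ker q).subtype q Subtype.val_injective hq (exact_ker q)
    (f.comp e)
  obtain ⟨q', hq'⟩ := facInj i hi (q.comp U.subtype) (fun x => (hip _).1 x.2)
  obtain ⟨f', hf'⟩ := fac q' (fun n => by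
    obtain ⟨x, hx⟩ := hq (i n)
    exact ⟨⟨x, by change p (q x) = 0; rw [hx]; exact (hip _).2 ⟨n, rfl⟩⟩,
      hi (by rw [hq']; exact hx)⟩) (f - g.comp U.subtype) (by
    intro w hw
    have h1 : q w.1 = 0 := by
      have := hq' w
      rw [hw, map_zero] at this
      exact this.symm
    have := hg ⟨w.1, h1⟩
    simp only [LinearMap.sub_apply, LinearMap.comp_apply, Submodule.subtype_apply] at this ⊢
    rw [this]
    exact sub_self (f w))
  obtain ⟨g', hg'⟩ := hext f'
  refine ⟨g + g'.comp q, fun x => ?_⟩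
  have h1 : q x.1 = i (q' x) := (hq' x).symm
  simp only [LinearMap.add_apply, LinearMap.comp_apply, Submodule.subtype_apply]
  rw [h1, hg', hf']
  simp

/-- hereditary: quotients in the second variable -/
theorem E0.quot_second (hA : Her A) (h : E0 A X Y) (p : Y →ₗ[A] Z)
    (hp : Function.Surjective p) : E0 A X Z := by
  obtain ⟨P, q, hP, hq⟩ := exists_free A X
  have : Module.Projective A (LinearMap.ker q) := hA P hP _
  refine E0.of_proj (LinearMap.ker q).subtype q hq (exact_ker _) ?_
  intro f
  obtain ⟨f', hf'⟩ := Module.projective_lifting_property p f hp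
  obtain ⟨g, hg⟩ := h _ P (LinearMap.ker q).subtype q Subtype.val_injective hq (exact_ker q) f'
  exact ⟨p.comp g, fun x => by
    rw [LinearMap.comp_apply, hg]; exact LinearMap.congr_fun hf' x⟩

theorem E0.ext_second (h1 : E0 A X N) (h2 : E0 A X Z) (i : N →ₗ[A] W) (p : W →ₗ[A] Z)
    (hi : Function.Injective i) (hp : Function.Surjective p) (hip : Function.Exact i p) :
    E0 A X W := by
  obtain ⟨P, q, hP, hq⟩ := exists_free A X
  refine E0.of_proj (LinearMap.ker q).subtype q hq (exact_ker _) ?_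
  intro f
  obtain ⟨g, hg⟩ := h2 _ P (LinearMap.ker q).subtype q Subtype.val_injective hq (exact_ker q)
    (p.comp f)
  obtain ⟨g', hg'⟩ := Module.projective_lifting_property p g hp
  have hg'' : ∀ x, p (g' x) = g x := fun x => LinearMap.congr_fun hg' x
  obtain ⟨f', hf'⟩ := facInj i hi (f - g'.comp (LinearMap.ker q).subtype) (fun x => by
    apply (hip _).1
    have := hg x
    simp only [LinearMap.sub_apply, LinearMap.comp_apply, map_sub, hg''] at this ⊢
    rw [this, sub_self])
  obtain ⟨g2, hg2⟩ := h1 _ P (LinearMap.ker q).subtype q Subtype.val_injective hq (exact_ker q) f'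
  refine ⟨g' + i.comp g2, fun x => ?_⟩
  rw [LinearMap.add_apply, LinearMap.comp_apply, hg2, hf']
  simp

theorem E0.ker_second (h : E0 A X W) (i : N →ₗ[A] W) (p : W →ₗ[A] Z)
    (hi : Function.Injective i) (hip : Function.Exact i p)
    (hl : ∀ f : X →ₗ[A] Z, ∃ g : X →ₗ[A] W, ∀ x, p (g x) = f x) : E0 A X N := by
  obtain ⟨P, q, hP, hq⟩ := exists_free A X
  refine E0.of_proj (LinearMap.ker q).subtype q hq (exact_ker _) ?_
  intro f
  obtain ⟨g, hg⟩ := h _ P (LinearMap.ker q).subtype q Subtype.val_injective hq (exact_ker q)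
    (i.comp f)
  obtain ⟨k, hk⟩ := fac q hq (p.comp g) (fun w hw => by
    have := hg ⟨w, hw⟩
    simp only [LinearMap.comp_apply, Submodule.subtype_apply] at this ⊢
    rw [this]; exact (hip _).2 ⟨_, rfl⟩)
  obtain ⟨l, hl⟩ := hl k
  obtain ⟨g', hg'⟩ := facInj i hi (g - l.comp q) (fun x => by
    apply (hip _).1
    simp [hl, hk])
  refine ⟨g', fun x => hi ?_⟩
  rw [hg']
  have h0 : q x.1 = 0 := x.2
  have := hg x
  simp only [LinearMap.sub_apply, LinearMap.comp_apply, Submodule.subtype_apply] at this ⊢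
  rw [this, h0, map_zero, sub_zero]

theorem E0.pi_second (h : E0 A X Y) (d : ℕ) : E0 A X (Fin d → Y) := by
  intro N W _ _ _ _ i p hi hp hip f
  choose g hg using fun k : Fin d => h N W i p hi hp hip ((LinearMap.proj k).comp f)
  exact ⟨LinearMap.pi g, fun x => by ext k; simp [hg]⟩

theorem proj_pi [Module.Projective A P] (d : ℕ) : Module.Projective A (Fin d → P) := by
  refine Module.Projective.of_lifting_property'' ?_
  intro f hf
  choose g hg using fun k : Fin d => Module.projective_lifting_property f
    (LinearMap.single A (fun _ : Fin d => P) k) hf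
  refine ⟨∑ k, (g k).comp (LinearMap.proj k), ?_⟩
  refine LinearMap.pi_ext' fun i => ?_
  ext1 x
  have hx : (∑ k, (g k).comp (LinearMap.proj k)) (Pi.single i x) = g i x := by
    rw [LinearMap.sum_apply, Finset.sum_eq_single i]
    · simp
    · intro b _ hb; simp [hb]
    · simp
  simp only [LinearMap.comp_apply, LinearMap.single_apply, LinearMap.id_apply]
  rw [hx]
  exact LinearMap.congr_fun (hg i) x

theorem E0.pi_first (h : E0 A X Y) (d : ℕ) : E0 A (Fin d → X) Y := by
  obtain ⟨P, q, hP, hq⟩ := exists_free A X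
  let i : (Fin d → LinearMap.ker q) →ₗ[A] (Fin d → P) :=
    LinearMap.pi (fun k => (LinearMap.ker q).subtype.comp (LinearMap.proj k))
  let p : (Fin d → P) →ₗ[A] (Fin d → X) := LinearMap.pi (fun k => q.comp (LinearMap.proj k))
  have : Module.Projective A (Fin d → P) :=
    proj_pi d
  refine E0.of_proj i p ?_ ?_ ?_
  · intro x
    choose y hy using fun k => hq (x k)
    exact ⟨y, by ext k; simp [p, hy]⟩
  · intro x
    constructor
    · intro hx
      exact ⟨fun k => ⟨x k, congrFun hx k⟩, rfl⟩
    · rintro ⟨y, rfl⟩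
      ext k
      exact (y k).2
  · intro f
    choose g hg using fun k : Fin d => h _ P (LinearMap.ker q).subtype q Subtype.val_injective hq
      (exact_ker q) (f.comp (LinearMap.single A (fun _ : Fin d => LinearMap.ker q) k))
    refine ⟨∑ k, (g k).comp (LinearMap.proj k), fun x => ?_⟩
    have : x = ∑ k, Pi.single k (x k) := (Finset.univ_sum_single x).symm
    conv_rhs => rw [this]
    rw [map_sum]
    simp only [LinearMap.sum_apply, LinearMap.comp_apply, LinearMap.proj_apply]
    refine Finset.sum_congr rfl fun k _ => ?_
    exact hg k (x k)

theorem E0.congr_first (e : X ≃ₗ[A] X') (h : E0 A X Y) : E0 A X' Y := by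
  intro N W _ _ _ _ i p hi hp hip f
  refine h N W i (e.symm.toLinearMap.comp p) hi (e.symm.surjective.comp hp) ?_ f
  intro x
  rw [← hip x]; simp

/-- split extension -/
theorem E0.of_split (h : ∀ (W : Type u) [AddCommGroup W] [Module A W] (i : Y →ₗ[A] W)
    (p : W →ₗ[A] X), Function.Injective i → Function.Surjective p → Function.Exact i p →
    ∃ r : W →ₗ[A] Y, ∀ y, r (i y) = y) : E0 A X Y := by
  intro N W _ _ _ _ i p hi hp hip f
  let D : Submodule A (W × Y) := LinearMap.range (LinearMap.prod i (-f))
  have hD : ∀ n, (i n, - f n) ∈ D := fun n => ⟨n, rfl⟩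
  let pp : ((W × Y) ⧸ D) →ₗ[A] X := D.liftQ (p.comp (LinearMap.fst A W Y)) (by
    rintro _ ⟨n, rfl⟩
    exact (hip _).2 ⟨n, rfl⟩)
  obtain ⟨r, hr⟩ := h ((W × Y) ⧸ D) (D.mkQ.comp (LinearMap.inr A W Y)) pp (by
      rw [injective_iff_map_eq_zero]
      intro y hy
      have : ((0 : W), y) ∈ D := (Submodule.Quotient.mk_eq_zero D).1 hy
      obtain ⟨n, hn⟩ := this
      have h1 : i n = 0 := congrArg Prod.fst hn
      have h2 : - f n = y := congrArg Prod.snd hn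
      rw [← h2, (map_eq_zero_iff i hi).1 h1]; simp)
    (fun x => by
      obtain ⟨w, hw⟩ := hp x
      exact ⟨D.mkQ (w, 0), hw⟩)
    (by
      intro z
      constructor
      · obtain ⟨⟨w, y⟩, rfl⟩ := D.mkQ_surjective z
        intro hz
        obtain ⟨n, rfl⟩ := (hip w).1 hz
        refine ⟨y + f n, ?_⟩
        refine (Submodule.Quotient.eq D).2 ?_
        convert hD (-n) using 1
        simp
      · rintro ⟨y, rfl⟩
        exact map_zero p)
  refine ⟨r.comp (D.mkQ.comp (LinearMap.inl A W Y)), fun n => ?_⟩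
  have : D.mkQ (i n, 0) = D.mkQ (0, f n) := by
    refine (Submodule.Quotient.eq D).2 ?_
    convert hD n using 1
    simp
  have h2 := hr (f n)
  simp only [LinearMap.comp_apply, LinearMap.inl_apply, LinearMap.inr_apply] at h2 ⊢
  rw [this, h2]

/-- `Hom = Ext = 0`. -/
def Pp (A : Type u) [Ring A] (X Y : Type u) [AddCommGroup X] [Module A X] [AddCommGroup Y]
    [Module A Y] : Prop := (∀ f : X →ₗ[A] Y, f = 0) ∧ E0 A X Y

theorem Pp.pi_first (h : Pp A X Y) (d : ℕ) : Pp A (Fin d → X) Y := by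
  refine ⟨fun f => ?_, h.2.pi_first d⟩
  refine LinearMap.pi_ext' fun i => ?_
  rw [h.1 (f.comp _), LinearMap.zero_comp]

theorem Pp.pi_second (h : Pp A X Y) (d : ℕ) : Pp A X (Fin d → Y) := by
  refine ⟨fun f => ?_, h.2.pi_second d⟩
  ext x i
  exact LinearMap.congr_fun (h.1 ((LinearMap.proj i).comp f)) x

theorem Pp.ext_first (h1 : Pp A N Y) (h2 : Pp A Z Y) (i : N →ₗ[A] W) (p : W →ₗ[A] Z)
    (hi : Function.Injective i) (hp : Function.Surjective p) (hip : Function.Exact i p) :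
    Pp A W Y := by
  refine ⟨fun f => ?_, h1.2.ext_first h2.2 i p hi hp hip⟩
  obtain ⟨g, hg⟩ := fac p hp f (fun w hw => by
    obtain ⟨n, rfl⟩ := (hip w).1 hw
    exact LinearMap.congr_fun (h1.1 (f.comp i)) n)
  ext w
  rw [← hg, h2.1 g]; rfl

theorem Pp.ext_second (h1 : Pp A X N) (h2 : Pp A X Z) (i : N →ₗ[A] W) (p : W →ₗ[A] Z)
    (hi : Function.Injective i) (hp : Function.Surjective p) (hip : Function.Exact i p) :
    Pp A X W := by
  refine ⟨fun f => ?_, h1.2.ext_second h2.2 i p hi hp hip⟩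
  obtain ⟨g, hg⟩ := facInj i hi f (fun x => (hip _).1 (LinearMap.congr_fun (h2.1 (p.comp f)) x))
  ext x
  rw [← hg, h1.1 g]; simp

theorem Pp.range_first (hA : Her A) (h1 : Pp A W Y) (h2 : Pp A Z Y) (f : W →ₗ[A] Z) :
    Pp A (LinearMap.range f) Y := by
  refine ⟨fun g => ?_, h2.2.sub_first hA (LinearMap.range f).subtype Subtype.val_injective⟩
  ext ⟨_, w, rfl⟩
  exact LinearMap.congr_fun (h1.1 (g.comp f.rangeRestrict)) w

theorem Pp.ker_first (hA : Her A) (h1 : Pp A W Y) (h2 : Pp A Z Y) (f : W →ₗ[A] Z) :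
    Pp A (LinearMap.ker f) Y := by
  refine ⟨fun g => ?_, h1.2.sub_first hA (LinearMap.ker f).subtype Subtype.val_injective⟩
  obtain ⟨g', hg'⟩ := (h1.range_first hA h2 f).2 _ W (LinearMap.ker f).subtype f.rangeRestrict
    Subtype.val_injective f.surjective_rangeRestrict (by
      intro x; simp [Subtype.ext_iff]) g
  ext x
  rw [← hg', h1.1 g']; rfl

theorem Pp.coker_first (hA : Her A) (h1 : Pp A W Y) (h2 : Pp A Z Y) (f : W →ₗ[A] Z) :
    Pp A (Z ⧸ LinearMap.range f) Y := by
  refine ⟨fun g => ?_, ?_⟩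
  · apply Submodule.linearMap_qext
    rw [h2.1 (g.comp _), LinearMap.zero_comp]
  · refine h2.2.quot_first (LinearMap.range f).subtype (LinearMap.range f).mkQ
      Subtype.val_injective (Submodule.mkQ_surjective _) (exact_sub _) ?_
    intro g
    exact ⟨0, fun x => by rw [(h1.range_first hA h2 f).1 g]; rfl⟩

theorem Pp.range_second (hA : Her A) (h1 : Pp A X W) (h2 : Pp A X Z) (f : W →ₗ[A] Z) :
    Pp A X (LinearMap.range f) := by
  refine ⟨fun g => ?_, h1.2.quot_second hA f.rangeRestrict f.surjective_rangeRestrict⟩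
  ext x
  exact LinearMap.congr_fun (h2.1 ((LinearMap.range f).subtype.comp g)) x

theorem Pp.ker_second (h1 : Pp A X W) (h2 : Pp A X Z) (f : W →ₗ[A] Z) :
    Pp A X (LinearMap.ker f) := by
  refine ⟨fun g => ?_, ?_⟩
  · ext x
    exact LinearMap.congr_fun (h1.1 ((LinearMap.ker f).subtype.comp g)) x
  · refine h1.2.ker_second (LinearMap.ker f).subtype f Subtype.val_injective (exact_ker f) ?_
    intro g
    exact ⟨0, fun x => by rw [h2.1 g]; simp⟩

theorem Pp.coker_second (hA : Her A) (h1 : Pp A X W) (h2 : Pp A X Z) (f : W →ₗ[A] Z) :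
    Pp A X (Z ⧸ LinearMap.range f) := by
  refine ⟨fun g => ?_, h2.2.quot_second hA _ (Submodule.mkQ_surjective _)⟩
  obtain ⟨g', hg'⟩ := (h1.range_second hA h2 f).2.lift (LinearMap.range f).subtype
    (LinearMap.range f).mkQ Subtype.val_injective (Submodule.mkQ_surjective _) (exact_sub _) g
  ext x
  rw [← hg', h2.1 g']; simp

end E0theory

theorem homZero_iff (X Y : ModuleCat.{u} A) : homZero X Y ↔ ∀ f : X →ₗ[A] Y, f = 0 := by
  constructor
  · intro h f
    have := congrArg ModuleCat.Hom.hom (h (ModuleCat.ofHom f))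
    simpa using this
  · intro h f
    ext x
    rw [h f.hom]; rfl

theorem extZero_iff (X Y : ModuleCat.{u} A) : extZero X Y ↔ E0 A X Y := by
  constructor
  · intro h
    refine E0.of_split ?_
    intro W _ _ i p hi hp hip
    obtain ⟨s, hs⟩ := h (ModuleCat.of A W) (ModuleCat.ofHom i) (ModuleCat.ofHom p) (by
      ext x; exact (hip _).2 ⟨x, rfl⟩)
      (ModuleCat.shortComplex_shortExact _ hip hi hp)
    have hs' : ∀ x, p (s.hom x) = x := fun x =>
      LinearMap.congr_fun (congrArg ModuleCat.Hom.hom hs) x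
    obtain ⟨r, hr⟩ := facInj i hi (LinearMap.id - s.hom.comp p) (fun x => by
      apply (hip _).1
      simp [hs'])
    refine ⟨r, fun y => hi ?_⟩
    rw [hr]
    simp [(hip (i y)).2 ⟨y, rfl⟩]
  · intro h E i p w hs
    have hex := (ShortComplex.ShortExact.moduleCat_exact_iff_function_exact _).1 hs.exact
    have hi := hs.moduleCat_injective_f
    have hp := hs.moduleCat_surjective_g
    obtain ⟨s, hs⟩ := E0.lift h i.hom p.hom hi hp hex LinearMap.id
    exact ⟨ModuleCat.ofHom s, by ext x; exact hs x⟩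

theorem rperp_iff (X Y : ModuleCat.{u} A) : rperp X Y ↔ Pp A X Y := by
  rw [rperp, Pp, homZero_iff, extZero_iff]

theorem lperp_iff (X Y : ModuleCat.{u} A) : lperp X Y ↔ Pp A Y X := by
  rw [lperp, Pp, homZero_iff, extZero_iff]


section Fin

variable (K : Type u) [Field K] [Algebra K A]
variable {X Y Z W N P R M E : Type u} [AddCommGroup X] [Module A X] [AddCommGroup Y] [Module A Y]
  [AddCommGroup Z] [Module A Z] [AddCommGroup W] [Module A W] [AddCommGroup N] [Module A N]
  [AddCommGroup P] [Module A P] [AddCommGroup R] [Module A R] [AddCommGroup M] [Module A M]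
  [AddCommGroup E] [Module A E]

variable {K} in
/-- multiplication by a scalar -/
def mu (A : Type u) [Ring A] [Algebra K A] {X : Type u} [AddCommGroup X] [Module A X]
    (c : K) : X →ₗ[A] X where
  toFun x := algebraMap K A c • x
  map_add' x y := smul_add _ x y
  map_smul' a x := by
    simp only [RingHom.id_apply, smul_smul, Algebra.commutes c a]

variable {K} in
theorem mu_nat (c : K) (f : X →ₗ[A] Y) (x : X) : f (mu A c x) = mu A c (f x) := by
  simp [mu]

/-- the induced vector space structure -/
abbrev kmod (A : Type u) [Ring A] [Algebra K A] (Y : Type u) [AddCommGroup Y] [Module A Y] :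
    Module K Y := Module.compHom Y (algebraMap K A)

theorem ktower (A : Type u) [Ring A] [Algebra K A] (Y : Type u) [AddCommGroup Y] [Module A Y] :
    letI := kmod K A Y; IsScalarTower K A Y := by
  letI := kmod K A Y
  refine ⟨fun c a y => ?_⟩
  change (c • a) • y = algebraMap K A c • a • y
  rw [Algebra.smul_def, mul_smul]

theorem noeth (A : Type u) [Ring A] [Algebra K A] [FiniteDimensional K A] : IsNoetherianRing A :=
  isNoetherian_of_tower K (inferInstance : IsNoetherian K A)

theorem artin (A : Type u) [Ring A] [Algebra K A] [FiniteDimensional K A] : IsArtinianRing A :=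
  IsArtinianRing.of_finite K A

theorem subFinite [FiniteDimensional K A] [Module.Finite A W] (U : Submodule A W) :
    Module.Finite A U := by
  have := noeth K A
  infer_instance

theorem homComm : letI := kmod K A Y; SMulCommClass A K Y := by
  letI := kmod K A Y
  have := ktower K A Y
  infer_instance

theorem homFinite [FiniteDimensional K A] [Module.Finite A X] [Module.Finite A Y] :
    letI := kmod K A Y; haveI := homComm K (A := A) (Y := Y); Module.Finite K (X →ₗ[A] Y) := by
  letI := kmod K A Y
  letI := kmod K A X
  have := ktower K A X
  have := ktower K A Y
  have : Module.Finite K X := Module.Finite.trans A X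
  have : Module.Finite K Y := Module.Finite.trans A Y
  exact Module.Finite.of_injective (LinearMap.restrictScalarsₗ K A X Y K)
    (LinearMap.restrictScalars_injective K)

theorem Hfin [FiniteDimensional K A] [Module.Finite A X] [Module.Finite A Y] :
    ∃ (d : ℕ) (f : Fin d → (X →ₗ[A] Y)), ∀ g : X →ₗ[A] Y, ∃ c : Fin d → K,
      ∀ x, g x = ∑ i, f i (mu A (c i) x) := by
  letI := kmod K A Y
  have := homComm K (A := A) (Y := Y)
  have := homFinite K (A := A) (X := X) (Y := Y)
  let b := Module.finBasis K (X →ₗ[A] Y)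
  refine ⟨_, b, fun g => ⟨fun i => b.repr g i, fun x => ?_⟩⟩
  conv_lhs => rw [← b.sum_repr g]
  rw [LinearMap.sum_apply]
  refine Finset.sum_congr rfl fun i _ => ?_
  rw [mu_nat]; rfl

theorem pushout (i : N →ₗ[A] W) (p : W →ₗ[A] X) (hi : Function.Injective i)
    (hp : Function.Surjective p) (hip : Function.Exact i p) (f : N →ₗ[A] Y) :
    ∃ (M1 : ModuleCat.{u} A) (π : W × Y →ₗ[A] M1) (q : M1 →ₗ[A] X), Function.Surjective π ∧
      Function.Exact (i.prod (-f)) π ∧ Function.Injective (π.comp (LinearMap.inr A W Y)) ∧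
      Function.Surjective q ∧ Function.Exact (π.comp (LinearMap.inr A W Y)) q ∧
      ∀ w y, q (π (w, y)) = p w := by
  let D : Submodule A (W × Y) := LinearMap.range (LinearMap.prod i (-f))
  have hD : ∀ n, (i n, - f n) ∈ D := fun n => ⟨n, rfl⟩
  let pp : ((W × Y) ⧸ D) →ₗ[A] X := D.liftQ (p.comp (LinearMap.fst A W Y)) (by
    rintro _ ⟨n, rfl⟩
    exact (hip _).2 ⟨n, rfl⟩)
  refine ⟨ModuleCat.of A ((W × Y) ⧸ D), D.mkQ, pp, D.mkQ_surjective, ?_, ?_, ?_, ?_, ?_⟩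
  · intro x
    exact Submodule.Quotient.mk_eq_zero D
  · rw [injective_iff_map_eq_zero]
    intro y hy
    have : ((0 : W), y) ∈ D := (Submodule.Quotient.mk_eq_zero D).1 hy
    obtain ⟨n, hn⟩ := this
    have h1 : i n = 0 := congrArg Prod.fst hn
    have h2 : - f n = y := congrArg Prod.snd hn
    rw [← h2, (map_eq_zero_iff i hi).1 h1]; simp
  · intro x
    obtain ⟨w, hw⟩ := hp x
    exact ⟨D.mkQ (w, 0), hw⟩
  · intro z
    constructor
    · obtain ⟨⟨w, y⟩, rfl⟩ := D.mkQ_surjective z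
      intro hz
      obtain ⟨n, rfl⟩ := (hip w).1 hz
      refine ⟨y + f n, ?_⟩
      refine (Submodule.Quotient.eq D).2 ?_
      convert hD (-n) using 1
      simp
    · rintro ⟨y, rfl⟩
      exact map_zero p
  · intro w y; rfl

theorem rstep [FiniteDimensional K A] [Module.Finite A M] [Module.Finite A E] (hE : E0 A E E) :
    ∃ (M1 : ModuleCat.{u} A) (d : ℕ) (j : M →ₗ[A] M1) (q : M1 →ₗ[A] (Fin d → E)) (r : ℕ)
      (t : (Fin r → E) →ₗ[A] M1), Module.Finite A M1 ∧ Function.Injective j ∧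
      Function.Surjective q ∧ Function.Exact j q ∧ E0 A E M1 ∧
      ∀ (f : E →ₗ[A] M1) x, f x ∈ LinearMap.range t := by
  obtain ⟨s, p, hp⟩ := Module.Finite.exists_fin' A E
  have := subFinite K (LinearMap.ker p)
  obtain ⟨d, f, hf⟩ := Hfin K (A := A) (X := LinearMap.ker p) (Y := M)
  let i' : (Fin d → LinearMap.ker p) →ₗ[A] (Fin d → (Fin s → A)) :=
    LinearMap.pi (fun k => (LinearMap.ker p).subtype.comp (LinearMap.proj k))
  let p' : (Fin d → (Fin s → A)) →ₗ[A] (Fin d → E) :=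
    LinearMap.pi (fun k => p.comp (LinearMap.proj k))
  obtain ⟨M1, π, q, hπ, hπ2, hj, hq, hjq, hqπ⟩ := pushout i' p'
    (fun x y h => by
      funext k
      exact Subtype.ext (congrFun h k))
    (fun x => by
      choose y hy using fun k => hp (x k)
      exact ⟨y, by ext k; simp [p', hy]⟩)
    (by
      intro x
      constructor
      · intro hx
        exact ⟨fun k => ⟨x k, congrFun hx k⟩, rfl⟩
      · rintro ⟨y, rfl⟩
        ext k
        exact (y k).2)
    (∑ k, (f k).comp (LinearMap.proj k))
  have : Module.Finite A M1 := Module.Finite.of_surjective π hπ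
  obtain ⟨r, g, hg⟩ := Hfin K (A := A) (X := E) (Y := M1)
  refine ⟨M1, d, _, q, r, ∑ k, (g k).comp (LinearMap.proj k), this, hj, hq, hjq, ?_, ?_⟩
  · refine E0.of_proj (LinearMap.ker p).subtype p hp (exact_ker p) ?_
    intro φ
    obtain ⟨h2, hh2⟩ := (hE.pi_second d) _ _ (LinearMap.ker p).subtype p Subtype.val_injective hp
      (exact_ker p) (q.comp φ)
    obtain ⟨l, hl⟩ := Module.projective_lifting_property q h2 hq
    have hl' : ∀ x, q (l x) = h2 x := fun x => LinearMap.congr_fun hl x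
    obtain ⟨φ', hφ'⟩ := facInj _ hj (φ - l.comp (LinearMap.ker p).subtype) (fun x => by
      apply (hjq _).1
      have := hh2 x
      simp only [LinearMap.sub_apply, LinearMap.comp_apply, map_sub, hl'] at this ⊢
      rw [this, sub_self])
    obtain ⟨c, hc⟩ := hf φ'
    refine ⟨l + π.comp ((LinearMap.inl A _ _).comp (LinearMap.pi fun k => mu A (c k))), fun x => ?_⟩
    have h1 : π (i' (fun k => mu A (c k) x), 0) = π (0, φ' x) := by
      rw [← sub_eq_zero, ← map_sub]
      apply (hπ2 _).2
      refine ⟨fun k => mu A (c k) x, ?_⟩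
      rw [hc]
      simp
    have h3 := hφ' x
    simp only [LinearMap.sub_apply, LinearMap.comp_apply, LinearMap.inr_apply,
      LinearMap.add_apply, LinearMap.inl_apply] at h3 ⊢
    have h4 : (LinearMap.pi fun k => mu A (c k)) ((LinearMap.ker p).subtype x)
      = i' (fun k => mu A (c k) x) := by
      ext k; rfl
    rw [h4, h1, h3]
    abel
  · intro φ x
    obtain ⟨c, hc⟩ := hg φ
    refine ⟨fun k => mu A (c k) x, ?_⟩
    rw [hc]; simp

theorem E0.prod_first (h1 : E0 A X Y) (h2 : E0 A Z Y) : E0 A (X × Z) Y := by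
  refine E0.ext_first h2 h1 (LinearMap.inr A X Z) (LinearMap.fst A X Z) LinearMap.inr_injective
    LinearMap.fst_surjective ?_
  rintro ⟨x, z⟩
  constructor
  · rintro h
    exact ⟨z, by simp only [LinearMap.fst_apply] at h; simp [h]⟩
  · rintro ⟨y, hy⟩
    have := congrArg Prod.fst hy
    simpa using this.symm

theorem lstep [FiniteDimensional K A] [Module.Finite A M] [Module.Finite A E] (hE : E0 A E E) :
    ∃ (M1 : ModuleCat.{u} A) (d : ℕ) (j : (Fin d → E) →ₗ[A] M1) (q : M1 →ₗ[A] M),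
      Module.Finite A M1 ∧ Function.Injective j ∧
      Function.Surjective q ∧ Function.Exact j q ∧ E0 A M1 E := by
  obtain ⟨s, p, hp⟩ := Module.Finite.exists_fin' A M
  have := subFinite K (LinearMap.ker p)
  obtain ⟨d, f, hf⟩ := Hfin K (A := A) (X := LinearMap.ker p) (Y := E)
  obtain ⟨M1, π, q, hπ, hπ2, hj, hq, hjq, hqπ⟩ := pushout (LinearMap.ker p).subtype p
    Subtype.val_injective hp (exact_ker p) (LinearMap.pi f)
  have : Module.Finite A M1 := Module.Finite.of_surjective π hπ
  refine ⟨M1, d, _, q, this, hj, hq, hjq, ?_⟩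
  refine E0.quot_first (W := (Fin s → A) × (Fin d → E)) (E0.prod_first E0.proj (hE.pi_first d)) _ π
    (fun x y h => Subtype.ext (congrArg Prod.fst h)) hπ hπ2 ?_
  intro g
  obtain ⟨c, hc⟩ := hf g
  refine ⟨- (∑ k, (mu A (c k)).comp (LinearMap.proj k)).comp (LinearMap.snd A _ _), fun x => ?_⟩
  rw [hc]
  simp [mu_nat]

theorem approx [FiniteDimensional K A] [Module.Finite A M] [Module.Finite A E]
    (hb : ∀ f : E →ₗ[A] E, f ≠ 0 → Function.Bijective f) :
    ∃ (r : ℕ) (t : M →ₗ[A] (Fin r → E)),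
      (∀ f : M →ₗ[A] E, ∃ g : (Fin r → E) →ₗ[A] E, ∀ x, f x = g (t x)) ∧
      (∀ g : (Fin r → E) →ₗ[A] E, (∀ x, g (t x) = 0) → g = 0) := by
  classical
  have hex : ∃ (r : ℕ), ∃ (t : M →ₗ[A] (Fin r → E)),
      ∀ f : M →ₗ[A] E, ∃ g : (Fin r → E) →ₗ[A] E, ∀ x, f x = g (t x) := by
    obtain ⟨d, f, hf⟩ := Hfin K (A := A) (X := M) (Y := E)
    refine ⟨d, LinearMap.pi f, fun g => ?_⟩
    obtain ⟨c, hc⟩ := hf g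
    exact ⟨∑ k, (mu A (c k)).comp (LinearMap.proj k), fun x => by rw [hc]; simp [mu_nat]⟩
  obtain ⟨t, ht⟩ := Nat.find_spec hex
  have hmin := fun m => Nat.find_min (m := m) hex
  revert t hmin
  generalize Nat.find hex = r
  intro t ht hmin
  refine ⟨r, t, ht, fun g hg => ?_⟩
  by_contra hne
  have : ∃ i, g.comp (LinearMap.single A (fun _ : Fin r => E) i) ≠ 0 := by
    by_contra hcon
    push Not at hcon
    apply hne
    refine LinearMap.pi_ext' fun i => ?_
    rw [hcon i, LinearMap.zero_comp]
  obtain ⟨i, hγ⟩ := this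
  obtain ⟨r', rfl⟩ : ∃ r', r = r' + 1 := ⟨r - 1, by have := i.pos; omega⟩
  let G : Fin (r' + 1) → (E →ₗ[A] E) := fun l => g.comp (LinearMap.single A (fun _ => E) l)
  have hG : ∀ y, g y = ∑ l, G l (y l) := fun y => by
    conv_lhs => rw [← Finset.univ_sum_single y]
    rw [map_sum]; rfl
  let e := LinearEquiv.ofBijective (G i) (hb _ hγ)
  let t' : M →ₗ[A] (Fin r' → E) := LinearMap.pi (fun l => (LinearMap.proj (i.succAbove l)).comp t)
  let c0 : (Fin r' → E) →ₗ[A] E :=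
    - e.symm.toLinearMap.comp (∑ l, (G (i.succAbove l)).comp (LinearMap.proj l))
  let comps : Fin (r' + 1) → ((Fin r' → E) →ₗ[A] E) :=
    Fin.insertNth (α := fun _ => ((Fin r' → E) →ₗ[A] E)) i c0 (fun l => LinearMap.proj l)
  have hs : ∀ x, LinearMap.pi comps (t' x) = t x := by
    intro x
    funext l
    refine Fin.succAboveCases i (α := fun l => LinearMap.pi comps (t' x) l = t x l) ?_ ?_ l
    · have h0 := hg x
      rw [hG, Fin.sum_univ_succAbove _ i] at h0
      have h1 : G i (t x i) = - ∑ l, G (i.succAbove l) (t x (i.succAbove l)) :=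
        eq_neg_of_add_eq_zero_left h0
      have h2 : comps i = c0 := by simp [comps]
      rw [LinearMap.pi_apply, h2]
      apply e.injective
      change _ = G i (t x i)
      rw [h1]
      simp [c0, t']
    · intro l
      have h2 : comps (i.succAbove l) = LinearMap.proj l := by simp [comps]
      rw [LinearMap.pi_apply, h2]
      rfl
  refine hmin r' (Nat.lt_succ_self _) ⟨t', fun f => ?_⟩
  obtain ⟨h, hh⟩ := ht f
  exact ⟨h.comp (LinearMap.pi comps), fun x => by rw [LinearMap.comp_apply, hs, hh]⟩

/-- consequences of the approximation -/
theorem approx_Pp (hA : Her A) (hE : E0 A E E) (hM : E0 A M E) {r : ℕ} (t : M →ₗ[A] (Fin r → E))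
    (h1 : ∀ f : M →ₗ[A] E, ∃ g : (Fin r → E) →ₗ[A] E, ∀ x, f x = g (t x)) :
    Pp A (LinearMap.ker t) E ∧
    ((∀ g : (Fin r → E) →ₗ[A] E, (∀ x, g (t x) = 0) → g = 0) →
      Pp A ((Fin r → E) ⧸ LinearMap.range t) E) := by
  have hI : E0 A (LinearMap.range t) E :=
    (hE.pi_first r).sub_first hA (LinearMap.range t).subtype Subtype.val_injective
  refine ⟨⟨fun f => ?_, hM.sub_first hA (LinearMap.ker t).subtype Subtype.val_injective⟩,
    fun h2 => ⟨fun f => ?_, ?_⟩⟩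
  · obtain ⟨g, hg⟩ := hI _ M (LinearMap.ker t).subtype t.rangeRestrict
      Subtype.val_injective t.surjective_rangeRestrict (by
        intro x; simp [Subtype.ext_iff]) f
    obtain ⟨g', hg'⟩ := h1 g
    ext x
    have h0 : t x.1 = 0 := x.2
    rw [← hg, Submodule.subtype_apply, hg', h0, map_zero]; rfl
  · apply Submodule.linearMap_qext
    rw [LinearMap.zero_comp]
    apply h2
    intro x
    have h0 : (LinearMap.range t).mkQ (t x) = 0 := (Submodule.Quotient.mk_eq_zero _).2 ⟨x, rfl⟩
    rw [LinearMap.comp_apply, h0, map_zero]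
  · refine (hE.pi_first r).quot_first (LinearMap.range t).subtype (LinearMap.range t).mkQ
      Subtype.val_injective (Submodule.mkQ_surjective _) (exact_sub _) ?_
    intro f
    obtain ⟨g, hg⟩ := h1 (f.comp t.rangeRestrict)
    refine ⟨g, ?_⟩
    rintro ⟨_, x, rfl⟩
    exact (hg x).symm

/-- the dual of the regular module -/
def DA (K : Type u) [Field K] (A : Type u) [Ring A] [Algebra K A] : Type u := A →ₗ[K] K

instance : AddCommGroup (DA K A) := inferInstanceAs (AddCommGroup (A →ₗ[K] K))

/-- evaluation -/
def DA.ev (φ : DA K A) : A →ₗ[K] K := φ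

theorem DA.ext' {φ ψ : DA K A} (h : ∀ x, DA.ev K φ x = DA.ev K ψ x) : φ = ψ := LinearMap.ext h

instance : SMul A (DA K A) := ⟨fun a φ => (DA.ev K φ).comp (LinearMap.mulRight K a)⟩

theorem DA.smul_ev (a : A) (φ : DA K A) (x : A) : DA.ev K (a • φ) x = DA.ev K φ (x * a) := rfl

theorem DA.add_ev (φ ψ : DA K A) (x : A) : DA.ev K (φ + ψ) x = DA.ev K φ x + DA.ev K ψ x := rfl

theorem DA.zero_ev (x : A) : DA.ev K (0 : DA K A) x = 0 := rfl

instance : Module A (DA K A) where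
  one_smul φ := DA.ext' K fun x => by simp [DA.smul_ev]
  mul_smul a b φ := DA.ext' K fun x => by simp [DA.smul_ev, mul_assoc]
  smul_zero a := DA.ext' K fun x => by simp [DA.smul_ev, DA.zero_ev]
  zero_smul φ := DA.ext' K fun x => by simp [DA.smul_ev, DA.zero_ev]
  smul_add a φ ψ := DA.ext' K fun x => by simp [DA.smul_ev, DA.add_ev]
  add_smul a b φ := DA.ext' K fun x => by simp [DA.smul_ev, DA.add_ev, mul_add]

theorem DA.finite [FiniteDimensional K A] : Module.Finite A (DA K A) := by
  letI : Module K (DA K A) := inferInstanceAs (Module K (A →ₗ[K] K))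
  have : Module.Finite K (DA K A) := inferInstanceAs (Module.Finite K (A →ₗ[K] K))
  have : IsScalarTower K A (DA K A) := ⟨fun c a φ => DA.ext' K fun x => by
    change DA.ev K φ (x * (c • a)) = c • DA.ev K φ (x * a)
    rw [mul_smul_comm, map_smul]⟩
  exact Module.Finite.of_restrictScalars_finite K A (DA K A)

/-- the map to the dual attached to a functional -/
theorem DA.mk (F : letI := kmod K A W; W →ₗ[K] K) : ∃ g : W →ₗ[A] DA K A, ∀ w x,
    DA.ev K (g w) x = F (x • w) := by
  letI := kmod K A W
  have := ktower K A W
  let g : W →ₗ[A] DA K A :=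
    { toFun := fun w => (F.comp ((LinearMap.toSpanSingleton A W w).restrictScalars K) : A →ₗ[K] K)
      map_add' := fun v w => DA.ext' K fun x => by
        change F (x • (v + w)) = F (x • v) + F (x • w)
        rw [smul_add, map_add]
      map_smul' := fun a w => DA.ext' K fun x => by
        change F (x • (a • w)) = F ((x * a) • w)
        rw [mul_smul] }
  exact ⟨g, fun w x => rfl⟩

theorem DA.inj : E0 A X (DA K A) := by
  intro N W _ _ _ _ i p hi hp hip f
  letI := kmod K A W
  letI := kmod K A N
  have := ktower K A W
  have := ktower K A N
  obtain ⟨ψ, hψ⟩ := (i.restrictScalars K).exists_leftInverse_of_injective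
    (LinearMap.ker_eq_bot.2 hi)
  let F : N →ₗ[K] K :=
    { toFun := fun n => DA.ev K (f n) 1
      map_add' := fun v w => by rw [map_add]; rfl
      map_smul' := fun c v => by
        change DA.ev K (f (algebraMap K A c • v)) 1 = c • DA.ev K (f v) 1
        rw [map_smul, DA.smul_ev, one_mul, ← map_smul, Algebra.smul_def, mul_one] }
  obtain ⟨g, hg⟩ := DA.mk K (F.comp ψ)
  refine ⟨g, fun n => DA.ext' K fun x => ?_⟩
  rw [hg]
  have h1 : ψ (i (x • n)) = x • n := LinearMap.congr_fun hψ (x • n)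
  rw [← map_smul]
  change F (ψ (i (x • n))) = _
  rw [h1]
  change DA.ev K (f (x • n)) 1 = _
  rw [map_smul, DA.smul_ev, one_mul]

theorem DA.embed [FiniteDimensional K A] [Module.Finite A X] :
    ∃ (r : ℕ) (e : X →ₗ[A] (Fin r → DA K A)), Function.Injective e := by
  letI := kmod K A X
  have := ktower K A X
  have : Module.Finite K X := Module.Finite.trans A X
  let b := Module.finBasis K X
  choose g hg using fun i => DA.mk K (b.coord i)
  refine ⟨_, LinearMap.pi g, ?_⟩
  rw [injective_iff_map_eq_zero]
  intro x hx
  apply b.ext_elem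
  intro i
  have h1 := hg i x 1
  have h2 : g i x = 0 := congrFun hx i
  rw [h2, one_smul] at h1
  simpa [DA.zero_ev] using h1.symm

end Fin


section Num

variable (K : Type u) [Field K] [Algebra K A]
variable {X Y Z W N P R P' R' : Type u} [AddCommGroup X] [Module A X] [AddCommGroup Y] [Module A Y]
  [AddCommGroup Z] [Module A Z] [AddCommGroup W] [Module A W] [AddCommGroup N] [Module A N]
  [AddCommGroup P] [Module A P] [AddCommGroup R] [Module A R]
  [AddCommGroup P'] [Module A P'] [AddCommGroup R'] [Module A R']

/-- dimension of the space of homomorphisms -/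
noncomputable def hm (K : Type u) [Field K] (A : Type u) [Ring A] [Algebra K A]
    (X Y : Type u) [AddCommGroup X] [Module A X] [AddCommGroup Y] [Module A Y] : ℕ :=
  letI := kmod K A Y
  haveI := homComm K (A := A) (Y := Y)
  Module.finrank K (X →ₗ[A] Y)


theorem hm_zero (h : ∀ f : X →ₗ[A] Y, f = 0) : hm K A X Y = 0 := by
  letI := kmod K A Y
  have := homComm K (A := A) (Y := Y)
  have : Subsingleton (X →ₗ[A] Y) := ⟨fun f g => by rw [h f, h g]⟩
  change Module.finrank K (X →ₗ[A] Y) = 0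
  exact Module.finrank_zero_of_subsingleton

theorem hm_pos [FiniteDimensional K A] [Module.Finite A X] [Module.Finite A Y] (f : X →ₗ[A] Y) (hf : f ≠ 0) :
    0 < hm K A X Y := by
  letI := kmod K A Y
  have := homComm K (A := A) (Y := Y)
  have := homFinite K (A := A) (X := X) (Y := Y)
  have : Nontrivial (X →ₗ[A] Y) := ⟨f, 0, hf⟩
  change 0 < Module.finrank K (X →ₗ[A] Y)
  exact Module.finrank_pos

theorem hm_first [FiniteDimensional K A] [Module.Finite A W] [Module.Finite A N] [Module.Finite A Y]
    (i : N →ₗ[A] W) (p : W →ₗ[A] X)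
    (hp : Function.Surjective p) (hip : Function.Exact i p) :
    hm K A W Y ≤ hm K A X Y + hm K A N Y ∧
    ((∀ f : N →ₗ[A] Y, ∃ g : W →ₗ[A] Y, ∀ x, g (i x) = f x) →
      hm K A W Y = hm K A X Y + hm K A N Y) := by
  letI := kmod K A Y
  have := homComm K (A := A) (Y := Y)
  have := homFinite K (A := A) (X := W) (Y := Y)
  have := homFinite K (A := A) (X := N) (Y := Y)
  let a : (X →ₗ[A] Y) →ₗ[K] (W →ₗ[A] Y) :=
    { toFun := fun g => g.comp p, map_add' := fun _ _ => rfl, map_smul' := fun _ _ => rfl }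
  let b : (W →ₗ[A] Y) →ₗ[K] (N →ₗ[A] Y) :=
    { toFun := fun g => g.comp i, map_add' := fun _ _ => rfl, map_smul' := fun _ _ => rfl }
  have ha : Function.Injective a := by
    intro f g h
    ext x
    obtain ⟨w, rfl⟩ := hp x
    exact LinearMap.congr_fun h w
  have hab : LinearMap.ker b = LinearMap.range a := by
    ext g
    constructor
    · intro hg
      obtain ⟨g', hg'⟩ := fac p hp g (fun w hw => by
        obtain ⟨n, rfl⟩ := (hip w).1 hw
        exact LinearMap.congr_fun hg n)
      exact ⟨g', LinearMap.ext hg'⟩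
    · rintro ⟨g', rfl⟩
      refine LinearMap.ext fun n => ?_
      change g' (p (i n)) = 0
      rw [(hip _).2 ⟨n, rfl⟩, map_zero]
  have h1 := LinearMap.finrank_range_add_finrank_ker b
  rw [hab, LinearMap.finrank_range_of_inj ha] at h1
  have h2 := Submodule.finrank_le (LinearMap.range b)
  change Module.finrank K (W →ₗ[A] Y) ≤ Module.finrank K (X →ₗ[A] Y) + Module.finrank K (N →ₗ[A] Y) ∧
    (_ → Module.finrank K (W →ₗ[A] Y) = Module.finrank K (X →ₗ[A] Y) + Module.finrank K (N →ₗ[A] Y))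
  refine ⟨by omega, fun h => ?_⟩
  have hs : Function.Surjective b := fun f => by
    obtain ⟨g, hg⟩ := h f
    exact ⟨g, LinearMap.ext hg⟩
  rw [LinearMap.range_eq_top.2 hs, finrank_top] at h1
  omega

theorem hm_second [FiniteDimensional K A] [Module.Finite A X] [Module.Finite A W]
    (i : N →ₗ[A] W) (p : W →ₗ[A] Z) (hi : Function.Injective i) (hip : Function.Exact i p)
    (hl : ∀ f : X →ₗ[A] Z, ∃ g : X →ₗ[A] W, ∀ x, p (g x) = f x) :
    hm K A X W = hm K A X N + hm K A X Z := by
  letI := kmod K A W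
  letI := kmod K A N
  letI := kmod K A Z
  have := homComm K (A := A) (Y := W)
  have := homComm K (A := A) (Y := N)
  have := homComm K (A := A) (Y := Z)
  have := homFinite K (A := A) (X := X) (Y := W)
  let a : (X →ₗ[A] N) →ₗ[K] (X →ₗ[A] W) :=
    { toFun := fun g => i.comp g, map_add' := fun f g => by ext; simp,
      map_smul' := fun c f => LinearMap.ext fun x => map_smul i (algebraMap K A c) (f x) }
  let b : (X →ₗ[A] W) →ₗ[K] (X →ₗ[A] Z) :=
    { toFun := fun g => p.comp g, map_add' := fun f g => by ext; simp,
      map_smul' := fun c f => LinearMap.ext fun x => map_smul p (algebraMap K A c) (f x) }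
  have ha : Function.Injective a := by
    intro f g h
    ext x
    exact hi (LinearMap.congr_fun h x)
  have hab : LinearMap.ker b = LinearMap.range a := by
    ext g
    constructor
    · intro hg
      obtain ⟨g', hg'⟩ := facInj i hi g (fun x => (hip _).1 (LinearMap.congr_fun hg x))
      exact ⟨g', LinearMap.ext hg'⟩
    · rintro ⟨g', rfl⟩
      refine LinearMap.ext fun n => ?_
      exact (hip _).2 ⟨_, rfl⟩
  have h1 := LinearMap.finrank_range_add_finrank_ker b
  have hs : Function.Surjective b := fun f => by
    obtain ⟨g, hg⟩ := hl f
    exact ⟨g, LinearMap.ext hg⟩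
  rw [hab, LinearMap.finrank_range_of_inj ha, LinearMap.range_eq_top.2 hs, finrank_top] at h1
  change Module.finrank K (X →ₗ[A] W) = Module.finrank K (X →ₗ[A] N) + Module.finrank K (X →ₗ[A] Z)
  omega

theorem schanuel [FiniteDimensional K A] [Module.Finite A P] [Module.Finite A P'] [Module.Finite A R] [Module.Finite A R']
    [Module.Finite A Y] [Module.Projective A P]
    [Module.Projective A P'] (i : R →ₗ[A] P) (p : P →ₗ[A] X) (hi : Function.Injective i)
    (hp : Function.Surjective p) (hip : Function.Exact i p)
    (i' : R' →ₗ[A] P') (p' : P' →ₗ[A] X) (hi' : Function.Injective i')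
    (hp' : Function.Surjective p') (hip' : Function.Exact i' p') :
    (hm K A P Y : ℤ) - hm K A R Y = hm K A P' Y - hm K A R' Y := by
  let D : Submodule A (P × P') :=
    LinearMap.ker (p.comp (LinearMap.fst A P P') - p'.comp (LinearMap.snd A P P'))
  have hD : ∀ b : P × P', b ∈ D ↔ p b.1 = p' b.2 := fun b => by
    simp [D, sub_eq_zero]
  have hpi : ∀ r, p (i r) = 0 := fun r => (hip _).2 ⟨r, rfl⟩
  have hpi' : ∀ r, p' (i' r) = 0 := fun r => (hip' _).2 ⟨r, rfl⟩
  have := subFinite K D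
  have h1 := (hm_first K (Y := Y) (((LinearMap.inl A P P').comp i).codRestrict D
    (fun r => by rw [hD]; simp [hpi])) ((LinearMap.snd A P P').comp D.subtype)
    (fun x => by
      obtain ⟨y, hy⟩ := hp (p' x)
      exact ⟨⟨(y, x), (hD _).2 hy⟩, rfl⟩)
    (by
      rintro ⟨⟨a, b⟩, hab⟩
      rw [hD] at hab
      constructor
      · intro h
        have hb : b = 0 := h
        subst hb
        obtain ⟨r, rfl⟩ := (hip a).1 (by simpa using hab)
        exact ⟨r, rfl⟩
      · rintro ⟨r, hr⟩
        have := congrArg (fun z => z.1.2) hr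
        exact this.symm)).2 (fun f => by
      refine E0.proj (A := A) (P := P') _ _ _ ((LinearMap.snd A P P').comp D.subtype) ?_ ?_ ?_ f
      · intro x y h
        exact hi (congrArg (fun z => z.1.1) h)
      · intro x
        obtain ⟨y, hy⟩ := hp (p' x)
        exact ⟨⟨(y, x), (hD _).2 hy⟩, rfl⟩
      · rintro ⟨⟨a, b⟩, hab⟩
        rw [hD] at hab
        constructor
        · intro h
          have hb : b = 0 := h
          subst hb
          obtain ⟨r, rfl⟩ := (hip a).1 (by simpa using hab)
          exact ⟨r, rfl⟩
        · rintro ⟨r, hr⟩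
          have := congrArg (fun z => z.1.2) hr
          exact this.symm)
  have hs : Function.Surjective ((LinearMap.fst A P P').comp D.subtype) := fun x => by
      obtain ⟨y, hy⟩ := hp' (p x)
      exact ⟨⟨(x, y), (hD _).2 hy.symm⟩, rfl⟩
  have he : Function.Exact (((LinearMap.inr A P P').comp i').codRestrict D
    (fun r => by rw [hD]; simp [hpi'])) ((LinearMap.fst A P P').comp D.subtype) := by
    rintro ⟨⟨a, b⟩, hab⟩
    rw [hD] at hab
    constructor
    · intro h
      have hb : a = 0 := h
      subst hb
      obtain ⟨r, rfl⟩ := (hip' b).1 (by simpa using hab.symm)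
      exact ⟨r, rfl⟩
    · rintro ⟨r, hr⟩
      have := congrArg (fun z => z.1.1) hr
      exact this.symm
  have h2 := (hm_first K (Y := Y) _ _ hs he).2 (fun f => by
      refine E0.proj (A := A) (P := P) _ _ _ ((LinearMap.fst A P P').comp D.subtype) ?_ hs he f
      intro x y h
      exact hi' (congrArg (fun z => z.1.2) h))
  omega

/-- Euler form -/
noncomputable def chi (K : Type u) [Field K] (A : Type u) [Ring A] [Algebra K A]
    (X Y : Type u) [AddCommGroup X] [Module A X] [AddCommGroup Y] [Module A Y]
    [Module.Finite A X] : ℤ :=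
  (hm K A (Fin (Module.Finite.exists_fin' A X).choose → A) Y : ℤ) -
    hm K A (LinearMap.ker (Module.Finite.exists_fin' A X).choose_spec.choose) Y

theorem chi_eq [FiniteDimensional K A] [Module.Finite A X] [Module.Finite A P] [Module.Finite A R]
    [Module.Finite A Y] [Module.Projective A P]
    (i : R →ₗ[A] P) (p : P →ₗ[A] X) (hi : Function.Injective i)
    (hp : Function.Surjective p) (hip : Function.Exact i p) :
    chi K A X Y = hm K A P Y - hm K A R Y := by
  have := subFinite K (LinearMap.ker (Module.Finite.exists_fin' A X).choose_spec.choose)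
  exact schanuel K (LinearMap.ker _).subtype _ Subtype.val_injective
    (Module.Finite.exists_fin' A X).choose_spec.choose_spec (exact_ker _) i p hi hp hip

theorem chi_le [FiniteDimensional K A] [Module.Finite A X] [Module.Finite A Y] :
    chi K A X Y ≤ hm K A X Y := by
  obtain ⟨r, p, hp⟩ := Module.Finite.exists_fin' A X
  have := subFinite K (LinearMap.ker p)
  rw [chi_eq K (LinearMap.ker p).subtype p Subtype.val_injective hp (exact_ker p)]
  have := (hm_first K (Y := Y) (LinearMap.ker p).subtype p hp (exact_ker p)).1
  omega

theorem chi_ext [FiniteDimensional K A] [Module.Finite A X] [Module.Finite A Y] (h : E0 A X Y) :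
    chi K A X Y = hm K A X Y := by
  obtain ⟨r, p, hp⟩ := Module.Finite.exists_fin' A X
  have := subFinite K (LinearMap.ker p)
  rw [chi_eq K (LinearMap.ker p).subtype p Subtype.val_injective hp (exact_ker p)]
  have := (hm_first K (Y := Y) (LinearMap.ker p).subtype p hp (exact_ker p)).2
    (h _ _ _ p Subtype.val_injective hp (exact_ker p))
  omega

theorem chi_Pp [FiniteDimensional K A] [Module.Finite A X] [Module.Finite A Y] (h : Pp A X Y) :
    chi K A X Y = 0 := by
  rw [chi_ext K h.2, hm_zero K h.1]; rfl

theorem chi_second [FiniteDimensional K A] (hA : Her A) [Module.Finite A X] [Module.Finite A W] [Module.Finite A N]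
    [Module.Finite A Z]
    (i : N →ₗ[A] W) (q : W →ₗ[A] Z) (hi : Function.Injective i) (hq : Function.Surjective q)
    (hiq : Function.Exact i q) : chi K A X W = chi K A X N + chi K A X Z := by
  obtain ⟨r, p, hp⟩ := Module.Finite.exists_fin' A X
  have := subFinite K (LinearMap.ker p)
  have : Module.Projective A (LinearMap.ker p) := hA _ inferInstance _
  rw [chi_eq K (LinearMap.ker p).subtype p Subtype.val_injective hp (exact_ker p),
    chi_eq K (LinearMap.ker p).subtype p Subtype.val_injective hp (exact_ker p),
    chi_eq K (LinearMap.ker p).subtype p Subtype.val_injective hp (exact_ker p)]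
  have h1 := hm_second K (X := Fin r → A) i q hi hiq (fun f => by
    obtain ⟨g, hg⟩ := Module.projective_lifting_property q f hq
    exact ⟨g, LinearMap.congr_fun hg⟩)
  have h2 := hm_second K (X := LinearMap.ker p) i q hi hiq (fun f => by
    obtain ⟨g, hg⟩ := Module.projective_lifting_property q f hq
    exact ⟨g, LinearMap.congr_fun hg⟩)
  omega

theorem chi_first [FiniteDimensional K A] (hA : Her A) [Module.Finite A Y] [Module.Finite A W] [Module.Finite A N]
    [Module.Finite A Z]
    (i : N →ₗ[A] W) (q : W →ₗ[A] Z) (hi : Function.Injective i) (hq : Function.Surjective q)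
    (hiq : Function.Exact i q) : chi K A W Y = chi K A N Y + chi K A Z Y := by
  obtain ⟨r, p, hp⟩ := Module.Finite.exists_fin' A W
  have := subFinite K (LinearMap.ker p)
  let U : Submodule A (Fin r → A) := LinearMap.ker (q.comp p)
  have := subFinite K U
  have : Module.Projective A U := hA _ inferInstance _
  rw [chi_eq K (LinearMap.ker p).subtype p Subtype.val_injective hp (exact_ker p),
    chi_eq K U.subtype (q.comp p) Subtype.val_injective (hq.comp hp) (exact_ker _)]
  obtain ⟨p', hp'⟩ := facInj i hi (p.comp U.subtype) (fun x => (hiq _).1 x.2)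
  have hU : ∀ x, p x = 0 → x ∈ U := fun x hx => by
    change q (p x) = 0
    rw [hx, map_zero]
  rw [chi_eq K (X := N) ((LinearMap.ker p).subtype.codRestrict U (fun x => hU _ x.2)) p'
    (fun x y h => Subtype.ext (congrArg (fun z : U => z.1) h))
    (fun n => by
      obtain ⟨x, hx⟩ := hp (i n)
      have hxU : x ∈ U := by
        change q (p x) = 0
        rw [hx]; exact (hiq _).2 ⟨n, rfl⟩
      exact ⟨⟨x, hxU⟩, hi (by rw [hp']; exact hx)⟩)
    (by
      intro x
      have : p' x = 0 ↔ p x.1 = 0 := by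
        rw [← map_eq_zero_iff i hi, hp']; rfl
      rw [this]
      constructor
      · intro h
        exact ⟨⟨x.1, h⟩, rfl⟩
      · rintro ⟨y, rfl⟩
        exact y.2)]
  omega

end Num

section Span

variable (K : Type u) [Field K] [Algebra K A]
variable {X Y Z W N P S T : Type u} [AddCommGroup X] [Module A X] [AddCommGroup Y] [Module A Y]
  [AddCommGroup Z] [Module A Z] [AddCommGroup W] [Module A W] [AddCommGroup N] [Module A N]
  [AddCommGroup P] [Module A P] [AddCommGroup S] [Module A S]
  [AddCommGroup T] [Module A T]

/-- index type of finitely generated modules -/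
abbrev Idx (A : Type u) [Ring A] := {X : ModuleCat.{u} A // Module.Finite A X}

/-- class of a module -/
noncomputable def wc (K : Type u) [Field K] (A : Type u) [Ring A] [Algebra K A] (M : Type u)
    [AddCommGroup M] [Module A M] [Module.Finite A M] : Idx A → ℚ × ℚ :=
  fun X => haveI := X.2; ((chi K A X.1 M : ℚ), (chi K A M X.1 : ℚ))

theorem wc_fst [Module.Finite A X] [Module.Finite A Y] :
    (wc K A Y ⟨ModuleCat.of A X, (inferInstance : Module.Finite A X)⟩).1 = chi K A X Y := rfl

theorem wc_snd [Module.Finite A X] [Module.Finite A Y] :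
    (wc K A Y ⟨ModuleCat.of A X, (inferInstance : Module.Finite A X)⟩).2 = chi K A Y X := rfl

theorem wc_add [FiniteDimensional K A] (hA : Her A) [Module.Finite A W] [Module.Finite A N]
    [Module.Finite A Z]
    (i : N →ₗ[A] W) (q : W →ₗ[A] Z) (hi : Function.Injective i) (hq : Function.Surjective q)
    (hiq : Function.Exact i q) : wc K A W = wc K A N + wc K A Z := by
  funext X
  have := X.2
  refine Prod.ext ?_ ?_
  · change (chi K A X.1 W : ℚ) = (chi K A X.1 N : ℚ) + (chi K A X.1 Z : ℚ)
    rw [chi_second K hA i q hi hq hiq]; push_cast; rfl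
  · change (chi K A W X.1 : ℚ) = (chi K A N X.1 : ℚ) + (chi K A Z X.1 : ℚ)
    rw [chi_first K hA i q hi hq hiq]; push_cast; rfl

theorem wc_zero [FiniteDimensional K A] (hA : Her A) [Subsingleton W] : wc K A W = 0 := by
  have := wc_add K hA (0 : W →ₗ[A] W) (0 : W →ₗ[A] W) (Function.injective_of_subsingleton _)
    (fun x => ⟨x, Subsingleton.elim _ _⟩)
    (fun x => ⟨fun _ => ⟨x, Subsingleton.elim _ _⟩, fun _ => Subsingleton.elim _ _⟩)
  simpa using this

theorem wc_congr [FiniteDimensional K A] (hA : Her A) [Module.Finite A W] [Module.Finite A N]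
    (e : N ≃ₗ[A] W) : wc K A N = wc K A W := by
  have := wc_add K hA e.toLinearMap (0 : W →ₗ[A] PUnit.{u+1}) e.injective
    (fun x => ⟨0, Subsingleton.elim _ _⟩)
    (fun x => ⟨fun _ => ⟨e.symm x, by simp⟩, fun _ => rfl⟩)
  rw [this, wc_zero K hA (W := PUnit.{u+1}), add_zero]

theorem wc_pi [FiniteDimensional K A] (hA : Her A) [Module.Finite A X]
    (V : Submodule ℚ (Idx A → ℚ × ℚ)) (h : wc K A X ∈ V) (d : ℕ) : wc K A (Fin d → X) ∈ V := by
  induction d with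
  | zero => rw [wc_zero K hA]; exact V.zero_mem
  | succ d ih =>
    let i : (Fin d → X) →ₗ[A] (Fin (d + 1) → X) :=
      { toFun := fun x => Fin.cons 0 x
        map_add' := fun x y => by
          funext l; refine Fin.cases ?_ (fun l => ?_) l <;> simp
        map_smul' := fun a x => by
          funext l; refine Fin.cases ?_ (fun l => ?_) l <;> simp }
    rw [wc_add K hA i (LinearMap.proj 0) (fun x y h => by
        funext l; simpa [i] using congrFun h l.succ)
      (fun x => ⟨fun _ => x, rfl⟩) (fun x => by
        constructor
        · intro h
          refine ⟨fun l => x l.succ, ?_⟩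
          funext l
          refine Fin.cases ?_ (fun l => ?_) l
          · exact h.symm
          · rfl
        · rintro ⟨y, rfl⟩; rfl)]
    exact V.add_mem ih h

theorem finLen [FiniteDimensional K A] [Module.Finite A X] : IsFiniteLength A X := by
  have := noeth K A
  have := artin K A
  exact isFiniteLength_iff_isNoetherian_isArtinian.2 ⟨inferInstance, inferInstance⟩

theorem simpleFin [IsSimpleModule A S] : Module.Finite A S := inferInstance

theorem wc_mem [FiniteDimensional K A] (hA : Her A) (V : Submodule ℚ (Idx A → ℚ × ℚ))
    (hV : ∀ (S : Type u) [AddCommGroup S] [Module A S] [IsSimpleModule A S], wc K A S ∈ V)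
    (M : Type u) [AddCommGroup M] [Module A M] [hM : Module.Finite A M] : wc K A M ∈ V := by
  have hl := finLen (A := A) K (X := M)
  revert hM
  induction hl with
  | of_subsingleton =>
    intro hM
    rw [wc_zero K hA]; exact V.zero_mem
  | @of_simple_quotient M _ _ U hU _ ih =>
    intro hM
    have := subFinite K U
    rw [wc_add K hA U.subtype U.mkQ Subtype.val_injective U.mkQ_surjective (exact_sub U)]
    exact V.add_mem ih (hV _)

/-- dimension of submodules -/
theorem dim_lt [FiniteDimensional K A] [Module.Finite A W] (U : Submodule A W) (hU : U ≠ ⊤) :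
    hm K A A U < hm K A A W := by
  have := subFinite K U
  have h1 := hm_second K (X := A) U.subtype U.mkQ Subtype.val_injective (exact_sub U) (fun f => by
    obtain ⟨g, hg⟩ := Module.projective_lifting_property U.mkQ f U.mkQ_surjective
    exact ⟨g, LinearMap.congr_fun hg⟩)
  obtain ⟨x, hx⟩ : ∃ x, x ∉ U := by
    by_contra h
    push Not at h
    exact hU (eq_top_iff.2 fun x _ => h x)
  have h2 := hm_pos K (LinearMap.toSpanSingleton A (W ⧸ U) (U.mkQ x)) (fun h => by
    have := LinearMap.congr_fun h 1
    simp [hx] at this)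
  omega

/-- minimal size of a projective cover -/
noncomputable def sd (K : Type u) [Field K] (A : Type u) [Ring A] [Algebra K A] (S : Type u)
    [AddCommGroup S] [Module A S] : ℕ :=
  sInf {d | ∃ (P : ModuleCat.{u} A) (p : P →ₗ[A] S), Module.Finite A P ∧ Module.Projective A P ∧
    Function.Surjective p ∧ hm K A A P = d}

theorem sd_le [Module.Finite A P] [Module.Projective A P] (p : P →ₗ[A] S)
    (hp : Function.Surjective p) : sd K A S ≤ hm K A A P :=
  Nat.sInf_le ⟨ModuleCat.of A P, p, ‹_›, ‹_›, hp, rfl⟩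

theorem mincover (S : Type u) [AddCommGroup S] [Module A S] [Module.Finite A S] :
    ∃ (P : ModuleCat.{u} A) (p : P →ₗ[A] S), Module.Finite A P ∧ Module.Projective A P ∧
    Function.Surjective p ∧ hm K A A P = sd K A S := by
  obtain ⟨r, p, hp⟩ := Module.Finite.exists_fin' A S
  exact Nat.sInf_mem (s := {d | ∃ (P : ModuleCat.{u} A) (p : P →ₗ[A] S), Module.Finite A P ∧
    Module.Projective A P ∧ Function.Surjective p ∧ hm K A A P = d})
    ⟨_, ModuleCat.of A (Fin r → A), p, inferInstanceAs (Module.Finite A (Fin r → A)),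
      inferInstanceAs (Module.Projective A (Fin r → A)), hp, rfl⟩

theorem simple_ext [FiniteDimensional K A] (hA : Her A) [IsSimpleModule A S] [IsSimpleModule A T]
    (h : sd K A S ≤ sd K A T) : E0 A S T := by
  obtain ⟨P, p, hP, hP', hp, hd⟩ := mincover (A := A) K S
  refine E0.of_proj (LinearMap.ker p).subtype p hp (exact_ker p) fun f => ?_
  by_cases hf : f = 0
  · exact ⟨0, fun x => by rw [hf]; rfl⟩
  exfalso
  have hs := LinearMap.surjective_of_ne_zero hf
  have := subFinite K (LinearMap.ker p)
  have : Module.Projective A (LinearMap.ker p) := hA _ hP' _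
  have h1 := sd_le K f hs
  have h2 := dim_lt K (LinearMap.ker p) (fun h => by
    have := IsSimpleModule.nontrivial A S
    obtain ⟨s, hs⟩ := exists_ne (0 : S)
    obtain ⟨x, rfl⟩ := hp s
    have : x ∈ LinearMap.ker p := by rw [h]; trivial
    exact hs this)
  omega

/-- unbundled exceptional sequences -/
structure EF {n : ℕ} (E : Fin n → ModuleCat.{u} A) : Prop where
  fin : ∀ i, Module.Finite A (E i)
  rigid : ∀ i, E0 A (E i) (E i)
  nt : ∀ i, Nontrivial (E i)
  brick : ∀ i (f : E i →ₗ[A] E i), f ≠ 0 → Function.Bijective f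
  perp : ∀ i j, i < j → Pp A (E j) (E i)

theorem EF_iff {n : ℕ} (E : Fin n → ModuleCat.{u} A) : IsExcSeq E ↔ EF E := by
  constructor
  · rintro ⟨h1, h2⟩
    refine ⟨fun i => (h1 i).1, fun i => (extZero_iff _ _).1 (h1 i).2.1, fun i => (h1 i).2.2.1,
      fun i f hf => ?_, fun i j hij => (rperp_iff _ _).1 (h2 i j hij)⟩
    have := (h1 i).2.2.2 (ModuleCat.ofHom f) (fun h => hf (by
      have := congrArg ModuleCat.Hom.hom h
      simpa using this))
    exact (CategoryTheory.ConcreteCategory.isIso_iff_bijective _).1 this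
  · intro h
    refine ⟨fun i => ⟨h.fin i, (extZero_iff _ _).2 (h.rigid i), h.nt i, fun f hf => ?_⟩,
      fun i j hij => (rperp_iff _ _).2 (h.perp i j hij)⟩
    refine (CategoryTheory.ConcreteCategory.isIso_iff_bijective _).2 (h.brick i f.hom fun h0 => ?_)
    apply hf
    ext x
    exact LinearMap.congr_fun h0 x

/-- pairwise nonisomorphic simples -/
def SimpleFam (A : Type u) [Ring A] (m : ℕ) (F : Fin m → ModuleCat.{u} A) : Prop :=
  (∀ i, IsSimpleModule A (F i)) ∧ ∀ i j, i ≠ j → IsEmpty (F i ≃ₗ[A] F j)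

theorem SimpleFam.le [FiniteDimensional K A] (hA : Her A) {n : ℕ} {E : Fin n → ModuleCat.{u} A}
    (hE : CompleteES E) {m : ℕ} {F : Fin m → ModuleCat.{u} A} (hF : SimpleFam A m F) : m ≤ n := by
  let σ := Tuple.sort (fun i => OrderDual.toDual (sd K A (F i)))
  have hσ := Tuple.monotone_sort (fun i => OrderDual.toDual (sd K A (F i)))
  refine hE.2 m (fun i => F (σ i)) ((EF_iff _).2 ?_)
  have hs := hF.1
  refine ⟨fun i => inferInstance, fun i => simple_ext K hA le_rfl,
    fun i => IsSimpleModule.nontrivial A _,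
    fun i f hf => (LinearMap.bijective_or_eq_zero f).resolve_right hf, fun i j hij => ⟨fun f => ?_, ?_⟩⟩
  · rcases LinearMap.bijective_or_eq_zero f with h | h
    · exact ((hF.2 (σ j) (σ i) (fun h => hij.ne' (σ.injective h))).false
        (LinearEquiv.ofBijective f h)).elim
    · exact h
  · exact simple_ext K hA (hσ hij.le)

theorem exists_simples [FiniteDimensional K A] (hA : Her A) {n : ℕ} {E : Fin n → ModuleCat.{u} A}
    (hE : CompleteES E) : ∃ (m : ℕ) (F : Fin m → ModuleCat.{u} A), m ≤ n ∧
      (∀ i, IsSimpleModule A (F i)) ∧ ∀ (T : Type u) [AddCommGroup T] [Module A T]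
        [IsSimpleModule A T], ∃ i, Nonempty (F i ≃ₗ[A] T) := by
  have : ∃ m, (∃ F, SimpleFam A m F) ∧ ¬ ∃ F, SimpleFam A (m + 1) F := by
    by_contra hcon
    push Not at hcon
    have : ∀ m, ∃ F, SimpleFam A m F := by
      intro m
      induction m with
      | zero => exact ⟨fun i => i.elim0, fun i => i.elim0, fun i => i.elim0⟩
      | succ m ih => exact hcon m ih
    obtain ⟨F, hF⟩ := this (n + 1)
    have := hF.le K hA hE
    omega
  obtain ⟨m, ⟨F, hF⟩, hm⟩ := this
  refine ⟨m, F, hF.le K hA hE, hF.1, fun T _ _ _ => ?_⟩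
  by_contra hT
  apply hm
  refine ⟨Fin.cons (ModuleCat.of A T) F, ?_, ?_⟩
  · intro i
    refine Fin.cases ?_ (fun i => ?_) i
    · exact ‹IsSimpleModule A T›
    · exact hF.1 i
  · intro i j
    refine Fin.cases ?_ (fun i => ?_) i
    · refine Fin.cases ?_ (fun j => ?_) j
      · intro h; exact absurd rfl h
      · intro _
        refine ⟨fun e => hT ⟨j, ⟨?_⟩⟩⟩
        exact LinearEquiv.symm e
    · refine Fin.cases ?_ (fun j => ?_) j
      · intro _
        exact ⟨fun e => hT ⟨i, ⟨e⟩⟩⟩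
      · intro h
        exact hF.2 i j (fun hh => h (by rw [hh]))

theorem chi_self_pos [FiniteDimensional K A] {n : ℕ} {E : Fin n → ModuleCat.{u} A}
    [hf : ∀ i, Module.Finite A (E i)] (hE : EF E) (i : Fin n) : 0 < chi K A (E i) (E i) := by
  rw [chi_ext K (hE.rigid i)]
  have := hE.nt i
  obtain ⟨x, hx⟩ := exists_ne (0 : E i)
  have := hm_pos K (A := A) (LinearMap.id : E i →ₗ[A] E i) (fun h => hx (LinearMap.congr_fun h x))
  exact_mod_cast this

theorem wc_indep [FiniteDimensional K A] {n : ℕ} {E : Fin n → ModuleCat.{u} A}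
    [hf : ∀ i, Module.Finite A (E i)] (hE : EF E) :
    LinearIndependent ℚ (fun i => wc K A (E i)) := by
  rw [Fintype.linearIndependent_iff]
  intro a ha
  have hX : ∀ i, ∑ j, a j * (chi K A (E i) (E j) : ℚ) = 0 := by
    intro i
    have := congrArg Prod.fst (congrFun ha ⟨E i, hf i⟩)
    simpa [Finset.sum_apply, Prod.fst_sum, wc] using this
  have : ∀ m : ℕ, ∀ i : Fin n, n ≤ i.1 + m → a i = 0 := by
    intro m
    induction m with
    | zero => intro i hi; have := i.2; omega
    | succ m ih =>
      intro i hi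
      have h1 := hX i
      rw [Finset.sum_eq_single i] at h1
      · have := chi_self_pos K hE i
        rcases mul_eq_zero.1 h1 with h | h
        · exact h
        · have h' : chi K A (E i) (E i) = 0 := by exact_mod_cast h
          omega
      · intro j _ hj
        rcases lt_or_gt_of_ne hj with h | h
        · rw [chi_Pp K (hE.perp j i h)]; simp
        · have : i.1 < j.1 := h
          rw [ih j (by omega), zero_mul]
      · simp
  intro i
  exact this n i (by omega)

theorem wc_span [FiniteDimensional K A] (hA : Her A) {n : ℕ} {E : Fin n → ModuleCat.{u} A}
    [hf : ∀ i, Module.Finite A (E i)] (hE : CompleteES E) (M : Type u) [AddCommGroup M] [Module A M]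
    [Module.Finite A M] : ∃ a : Fin n → ℚ, ∑ i, a i • wc K A (E i) = wc K A M := by
  obtain ⟨m, F, hmn, hF, hT⟩ := exists_simples K hA hE
  let V := Submodule.span ℚ (Set.range fun i => wc K A (F i))
  have hV := wc_mem K hA V (fun S _ _ _ => by
    obtain ⟨i, ⟨e⟩⟩ := hT S
    rw [← wc_congr K hA e]
    exact Submodule.subset_span ⟨i, rfl⟩)
  have hEF := (EF_iff E).1 hE.1
  have hle : Submodule.span ℚ (Set.range fun i => wc K A (E i)) ≤ V := by
    rw [Submodule.span_le]
    rintro _ ⟨i, rfl⟩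
    exact hV (E i)
  have hfd : FiniteDimensional ℚ V := FiniteDimensional.span_of_finite ℚ (Set.finite_range _)
  have h1 := finrank_span_eq_card (wc_indep K hEF)
  have h2 : Module.finrank ℚ V ≤ m := by
    have := finrank_range_le_card (R := ℚ) (fun i => wc K A (F i))
    rw [Fintype.card_fin] at this
    exact this
  have h3 := Submodule.eq_of_le_of_finrank_le hle (by rw [h1, Fintype.card_fin]; omega)
  have h4 := hV M
  rw [← h3] at h4
  exact (Submodule.mem_span_range_iff_exists_fun ℚ).1 h4

theorem coef_fst {n : ℕ} {E : Fin n → ModuleCat.{u} A}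
    [hf : ∀ i, Module.Finite A (E i)] [Module.Finite A W] [Module.Finite A X] {a : Fin n → ℚ}
    (h : ∑ i, a i • wc K A (E i) = wc K A W) :
    (chi K A X W : ℚ) = ∑ i, a i * (chi K A X (E i) : ℚ) := by
  have := congrArg Prod.fst (congrFun h ⟨ModuleCat.of A X, ‹Module.Finite A X›⟩)
  simp only [Finset.sum_apply, Prod.fst_sum, wc] at this
  exact this.symm

theorem coef_snd {n : ℕ} {E : Fin n → ModuleCat.{u} A}
    [hf : ∀ i, Module.Finite A (E i)] [Module.Finite A W] [Module.Finite A X] {a : Fin n → ℚ}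
    (h : ∑ i, a i • wc K A (E i) = wc K A W) :
    (chi K A W X : ℚ) = ∑ i, a i * (chi K A (E i) X : ℚ) := by
  have := congrArg Prod.snd (congrFun h ⟨ModuleCat.of A X, ‹Module.Finite A X›⟩)
  simp only [Finset.sum_apply, Prod.snd_sum, wc] at this
  exact this.symm

end Span

section Constr

variable (K : Type u) [Field K] [Algebra K A]
variable {M E C : Type u} [AddCommGroup M] [Module A M] [AddCommGroup E] [Module A E]
  [AddCommGroup C] [Module A C]

theorem exact_range (t : M →ₗ[A] E) : Function.Exact (LinearMap.ker t).subtype t.rangeRestrict := by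
  intro x; simp [Subtype.ext_iff]

theorem rfull [FiniteDimensional K A] (hA : Her A) [Module.Finite A M] [Module.Finite A E]
    (hE : E0 A E E) (hC : Pp A E C) (π : M →ₗ[A] C) :
    ∃ (M' : ModuleCat.{u} A) (π' : M' →ₗ[A] C), Module.Finite A M' ∧
      (Function.Surjective π → Function.Surjective π') ∧
      (∀ (Y : Type u) [AddCommGroup Y] [Module A Y], E0 A M Y → Pp A E Y → E0 A M' Y) ∧
      Pp A E M' ∧
      (∀ (X : Type u) [AddCommGroup X] [Module A X], Pp A X M → Pp A X E → Pp A X M') ∧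
      (∀ (Q : Type u) [AddCommGroup Q] [Module A Q], Pp A Q E → ∀ h : Q →ₗ[A] M',
        ∃ h' : Q →ₗ[A] M, ∀ x, π' (h x) = π (h' x)) := by
  obtain ⟨M1, d, j, q, r, t, hM1, hj, hq, hjq, hE1, ht⟩ := rstep (A := A) K (M := M) hE
  obtain ⟨g, hg⟩ := (hC.pi_first d).2 _ _ j q hj hq hjq π
  have hgt : ∀ y, g (t y) = 0 := fun y => LinearMap.congr_fun ((hC.pi_first r).1 (g.comp t)) y
  obtain ⟨π', hπ'⟩ := fac (LinearMap.range t).mkQ (Submodule.mkQ_surjective _) g (fun w hw => by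
    obtain ⟨y, rfl⟩ := (Submodule.Quotient.mk_eq_zero _).1 hw
    exact hgt y)
  refine ⟨ModuleCat.of A (M1 ⧸ LinearMap.range t), π', ?_, ?_, ?_, ⟨?_, ?_⟩, ?_, ?_⟩
  · exact inferInstanceAs (Module.Finite A (M1 ⧸ LinearMap.range t))
  · intro h c
    obtain ⟨m, rfl⟩ := h c
    exact ⟨(LinearMap.range t).mkQ (j m), by rw [← hg]; exact hπ' _⟩
  · intro Y _ _ h1 h2
    refine E0.quot_first (h1.ext_first (h2.pi_first d).2 j q hj hq hjq) (LinearMap.range t).subtype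
      (LinearMap.range t).mkQ Subtype.val_injective (Submodule.mkQ_surjective _) (exact_sub _) ?_
    intro f
    refine ⟨0, ?_⟩
    rintro ⟨_, y, rfl⟩
    exact (LinearMap.congr_fun ((h2.pi_first r).1 (f.comp t.rangeRestrict)) y).symm
  · intro f
    have h1 : E0 A E (LinearMap.range t) :=
      (hE.pi_second r).quot_second hA t.rangeRestrict t.surjective_rangeRestrict
    obtain ⟨f', hf'⟩ := h1.lift (LinearMap.range t).subtype
      (LinearMap.range t).mkQ Subtype.val_injective (Submodule.mkQ_surjective _) (exact_sub _) f
    refine LinearMap.ext fun x => ?_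
    rw [← hf']
    exact (Submodule.Quotient.mk_eq_zero _).2 (ht f' x)
  · exact hE1.quot_second hA _ (Submodule.mkQ_surjective _)
  · intro X _ _ h1 h2
    exact Pp.coker_second hA (h2.pi_second r) (h1.ext_second (h2.pi_second d) j q hj hq hjq) t
  · intro Q _ _ hQ h
    have h1 : E0 A Q (LinearMap.range t) :=
      (hQ.pi_second r).2.quot_second hA t.rangeRestrict t.surjective_rangeRestrict
    obtain ⟨f', hf'⟩ := h1.lift (LinearMap.range t).subtype
      (LinearMap.range t).mkQ Subtype.val_injective (Submodule.mkQ_surjective _) (exact_sub _) h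
    obtain ⟨h', hh'⟩ := facInj j hj f' (fun x => (hjq _).1
      (LinearMap.congr_fun ((hQ.pi_second d).1 (q.comp f')) x))
    refine ⟨h', fun x => ?_⟩
    rw [← hf', hπ', ← hh', hg]

theorem lfull [FiniteDimensional K A] (hA : Her A) [Module.Finite A M] [Module.Finite A E]
    (hE : E0 A E E) (hb : ∀ f : E →ₗ[A] E, f ≠ 0 → Function.Bijective f)
    (hC : Pp A C E) (ι : C →ₗ[A] M) (hι : Function.Injective ι) :
    ∃ (M' : ModuleCat.{u} A) (ι' : C →ₗ[A] M'), Module.Finite A M' ∧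
      Function.Injective ι' ∧
      (∀ (Y : Type u) [AddCommGroup Y] [Module A Y], E0 A Y M → Pp A Y E → E0 A Y M') ∧
      Pp A M' E ∧
      (∀ (X : Type u) [AddCommGroup X] [Module A X], Pp A M X → Pp A E X → Pp A M' X) := by
  obtain ⟨M1, d, j, q, hM1, hj, hq, hjq, hE1⟩ := lstep (A := A) K (M := M) hE
  obtain ⟨r, t, ht, -⟩ := approx (A := A) K (M := M1) hb
  obtain ⟨ι1, hι1⟩ := (hC.pi_second d).2.lift j q hj hq hjq ι
  refine ⟨ModuleCat.of A (LinearMap.ker t), ι1.codRestrict (LinearMap.ker t) (fun c =>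
    LinearMap.congr_fun ((hC.pi_second r).1 (t.comp ι1)) c), ?_, ?_, ?_, ?_, ?_⟩
  · exact subFinite K (LinearMap.ker t)
  · intro x y h
    have h1 : ι1 x = ι1 y := congrArg (fun z : LinearMap.ker t => z.1) h
    apply hι
    rw [← hι1, ← hι1, h1]
  · intro Y _ _ h1 h2
    refine E0.ker_second ((h2.pi_second d).2.ext_second h1 j q hj hq hjq)
      (LinearMap.ker t).subtype t Subtype.val_injective (exact_ker t) ?_
    intro f
    exact ⟨0, fun x => by rw [(h2.pi_second r).1 f]; simp⟩
  · exact (approx_Pp hA hE hE1 t ht).1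
  · intro X _ _ h1 h2
    exact Pp.ker_first hA ((h2.pi_first d).ext_first h1 j q hj hq hjq) (h2.pi_first r) t

theorem qfull [FiniteDimensional K A] (hA : Her A) [Module.Finite A M] [Module.Finite A E]
    (hE : E0 A E E) (hb : ∀ f : E →ₗ[A] E, f ≠ 0 → Function.Bijective f)
    (V : Submodule ℚ (Idx A → ℚ × ℚ)) (hM : wc K A M ∉ V) (hEV : wc K A E ∈ V) :
    ∃ (M' : Idx A), (haveI := M'.2; wc K A M'.1 ∉ V) ∧ Pp A M'.1 E ∧
      (∀ (X : Type u) [AddCommGroup X] [Module A X], Pp A M X → Pp A E X → Pp A M'.1 X) := by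
  obtain ⟨M1, d, j, q, hM1, hj, hq, hjq, hE1⟩ := lstep (A := A) K (M := M) hE
  obtain ⟨r, t, ht, ht2⟩ := approx (A := A) K (M := M1) hb
  have hf1 := subFinite K (LinearMap.ker t)
  have hf2 := subFinite K (LinearMap.range t)
  have hX : (∀ (X : Type u) [AddCommGroup X] [Module A X], Pp A M X → Pp A E X → Pp A M1 X) :=
    fun X _ _ h1 h2 => (h2.pi_first d).ext_first h1 j q hj hq hjq
  by_cases hN : wc K A (LinearMap.ker t) ∈ V
  · have e1 := wc_add K hA j q hj hq hjq
    have e2 := wc_add K hA (LinearMap.ker t).subtype t.rangeRestrict Subtype.val_injective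
      t.surjective_rangeRestrict (exact_range t)
    have e3 := wc_add K hA (LinearMap.range t).subtype (LinearMap.range t).mkQ Subtype.val_injective
      (Submodule.mkQ_surjective _) (exact_sub _)
    refine ⟨⟨ModuleCat.of A ((Fin r → E) ⧸ LinearMap.range t),
      inferInstanceAs (Module.Finite A ((Fin r → E) ⧸ LinearMap.range t))⟩, fun hc => hM ?_,
      (approx_Pp hA hE hE1 t ht).2 ht2, fun X _ _ h1 h2 =>
        Pp.coker_first hA (hX X h1 h2) (h2.pi_first r) t⟩
    have hc' : wc K A ((Fin r → E) ⧸ LinearMap.range t) ∈ V := hc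
    have hr : wc K A (LinearMap.range t) ∈ V := by
      have := V.sub_mem (wc_pi K hA V hEV r) hc'
      rwa [e3, add_sub_cancel_right] at this
    have h1 : wc K A M1 ∈ V := by
      rw [e2]; exact V.add_mem hN hr
    have := V.sub_mem h1 (wc_pi K hA V hEV d)
    rwa [e1, add_sub_cancel_left] at this
  · exact ⟨⟨ModuleCat.of A (LinearMap.ker t), hf1⟩, hN, (approx_Pp hA hE hE1 t ht).1,
      fun X _ _ h1 h2 => Pp.ker_first hA (hX X h1 h2) (h2.pi_first r) t⟩

end Constr

section Constr2

variable (K : Type u) [Field K] [Algebra K A]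

theorem MP [FiniteDimensional K A] (hA : Her A) {n : ℕ} {E : Fin n → ModuleCat.{u} A}
    (hE : EF E) (k : Fin n) : ∃ (r : ℕ) (p : (Fin r → A) →ₗ[A] E k) (M : ModuleCat.{u} A)
      (π : M →ₗ[A] E k), Module.Finite A M ∧ Function.Surjective π ∧
      (∀ (Y : Type u) [AddCommGroup Y] [Module A Y], (∀ j, k < j → Pp A (E j) Y) → E0 A M Y) ∧
      (∀ j, k < j → Pp A (E j) M) ∧
      (∀ (Q : Type u) [AddCommGroup Q] [Module A Q], (∀ j, k < j → Pp A Q (E j)) →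
        ∀ h : Q →ₗ[A] M, ∃ a : Q →ₗ[A] (Fin r → A), ∀ x, π (h x) = p (a x)) := by
  have hf := hE.fin
  obtain ⟨r, p, hp⟩ := Module.Finite.exists_fin' A (E k)
  refine ⟨r, p, ?_⟩
  have key : ∀ m : ℕ, ∃ (M : ModuleCat.{u} A)
      (π : M →ₗ[A] E k), Module.Finite A M ∧ Function.Surjective π ∧
      (∀ (Y : Type u) [AddCommGroup Y] [Module A Y], (∀ j, k < j → Pp A (E j) Y) → E0 A M Y) ∧
      (∀ j, k < j → n ≤ j.1 + m → Pp A (E j) M) ∧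
      (∀ (Q : Type u) [AddCommGroup Q] [Module A Q], (∀ j, k < j → Pp A Q (E j)) →
        ∀ h : Q →ₗ[A] M, ∃ a : Q →ₗ[A] (Fin r → A), ∀ x, π (h x) = p (a x)) := by
    intro m
    induction m with
    | zero =>
      refine ⟨ModuleCat.of A (Fin r → A), p, inferInstanceAs (Module.Finite A (Fin r → A)), hp,
        fun Y _ _ _ => ?_, fun j _ hj => absurd j.2 (by omega), fun Q _ _ _ h => ⟨h, fun x => rfl⟩⟩
      change E0 A (Fin r → A) Y
      exact E0.proj
    | succ m ih =>
      obtain ⟨M, π, h1, h2, h3, h4, h5⟩ := ih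
      by_cases hm : k.1 + (m + 1) < n
      · let j0 : Fin n := ⟨n - (m + 1), by omega⟩
        have hkj : k < j0 := by
          change k.1 < n - (m + 1)
          omega
        obtain ⟨M', π', g1, g2, g3, g4, g5, g6⟩ :=
          rfull K hA (hE.rigid j0) (hE.perp k j0 hkj) π
        refine ⟨M', π', g1, g2 h2, fun Y _ _ hY => g3 Y (h3 Y hY) (hY j0 hkj), ?_, ?_⟩
        · intro j hj hjm
          by_cases hjj : n ≤ j.1 + m
          · refine g5 _ (h4 j hj hjj) (hE.perp j0 j ?_)
            change n - (m + 1) < j.1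
            omega
          · have : j = j0 := Fin.ext (by change j.1 = n - (m + 1); omega)
            rw [this]; exact g4
        · intro Q _ _ hQ h
          obtain ⟨h', hh'⟩ := g6 Q (hQ j0 hkj) h
          obtain ⟨a, ha⟩ := h5 Q hQ h'
          exact ⟨a, fun x => by rw [hh', ha]⟩
      · refine ⟨M, π, h1, h2, h3, fun j hj hjm => h4 j hj ?_, h5⟩
        have : k.1 < j.1 := hj
        omega
  obtain ⟨M, π, h1, h2, h3, h4, h5⟩ := key n
  exact ⟨M, π, h1, h2, h3, fun j hj => h4 j hj (by omega), h5⟩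

theorem MI [FiniteDimensional K A] (hA : Her A) {n : ℕ} {E : Fin n → ModuleCat.{u} A}
    (hE : EF E) (k : Fin n) : ∃ (M : ModuleCat.{u} A)
      (ι : E k →ₗ[A] M), Module.Finite A M ∧ Function.Injective ι ∧
      (∀ (Y : Type u) [AddCommGroup Y] [Module A Y], (∀ j, j < k → Pp A Y (E j)) → E0 A Y M) ∧
      (∀ j, j < k → Pp A M (E j)) := by
  have hf := hE.fin
  have key : ∀ m : ℕ, ∃ (M : ModuleCat.{u} A)
      (ι : E k →ₗ[A] M), Module.Finite A M ∧ Function.Injective ι ∧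
      (∀ (Y : Type u) [AddCommGroup Y] [Module A Y], (∀ j, j < k → Pp A Y (E j)) → E0 A Y M) ∧
      (∀ j, j < k → j.1 < m → Pp A M (E j)) := by
    intro m
    induction m with
    | zero =>
      obtain ⟨r, e, he⟩ := DA.embed K (A := A) (X := E k)
      have := DA.finite (A := A) K
      refine ⟨ModuleCat.of A (Fin r → DA K A), e,
        inferInstanceAs (Module.Finite A (Fin r → DA K A)), he,
        fun Y _ _ _ => ?_, fun j _ hj => absurd hj (by omega)⟩
      exact (DA.inj K (A := A) (X := Y)).pi_second r
    | succ m ih =>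
      obtain ⟨M, ι, h1, h2, h3, h4⟩ := ih
      by_cases hm : m < k.1
      · let j0 : Fin n := ⟨m, by omega⟩
        have hkj : j0 < k := hm
        obtain ⟨M', ι', g1, g2, g3, g4, g5⟩ :=
          lfull K hA (hE.rigid j0) (hE.brick j0) (hE.perp j0 k hkj) ι h2
        refine ⟨M', ι', g1, g2, fun Y _ _ hY => g3 Y (h3 Y hY) (hY j0 hkj), ?_⟩
        intro j hj hjm
        by_cases hjj : j.1 < m
        · exact g5 _ (h4 j hj hjj) (hE.perp j j0 hjj)
        · have : j = j0 := Fin.ext (by change j.1 = m; omega)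
          rw [this]; exact g4
      · refine ⟨M, ι, h1, h2, h3, fun j hj hjm => h4 j hj ?_⟩
        have : j.1 < k.1 := hj
        omega
  obtain ⟨M, ι, h1, h2, h3, h4⟩ := key n
  exact ⟨M, ι, h1, h2, h3, fun j hj => h4 j hj j.2⟩

theorem MQ [FiniteDimensional K A] (hA : Her A) {n : ℕ} {E : Fin n → ModuleCat.{u} A}
    [hf : ∀ i, Module.Finite A (E i)]
    (hE : EF E) (k : Fin n) : ∃ (M : Idx A),
      (haveI := M.2; wc K A M.1 ≠ 0) ∧
      (∀ j, j ≠ k → Pp A M.1 (E j)) := by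
  let V := Submodule.span ℚ ((fun i => wc K A (E i)) '' {k}ᶜ)
  have hV : wc K A (E k) ∉ V := (wc_indep K hE).notMem_span k
  have hV' : ∀ j, j ≠ k → wc K A (E j) ∈ V := fun j hj =>
    Submodule.subset_span ⟨j, hj, rfl⟩
  have key : ∀ m : ℕ, ∃ (M : Idx A),
      (haveI := M.2; wc K A M.1 ∉ V) ∧
      (∀ j, j < k ∨ (k < j ∧ j.1 < m) → Pp A M.1 (E j)) := by
    intro m
    induction m with
    | zero =>
      refine ⟨⟨E k, hf k⟩, hV, fun j hj => ?_⟩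
      rcases hj with hj | hj
      · exact hE.perp j k hj
      · exact absurd hj.2 (by omega)
    | succ m ih =>
      obtain ⟨M, h1, h2⟩ := ih
      have := M.2
      by_cases hm : k.1 < m ∧ m < n
      · let j0 : Fin n := ⟨m, by omega⟩
        have hkj : k < j0 := hm.1
        obtain ⟨M', g1, g2, g3⟩ :=
          qfull K hA (hE.rigid j0) (hE.brick j0) V h1 (hV' j0 hkj.ne')
        refine ⟨M', g1, ?_⟩
        intro j hj
        by_cases hjj : j < k ∨ (k < j ∧ j.1 < m)
        · refine g3 _ (h2 j hjj) (hE.perp j j0 ?_)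
          rcases hjj with h | h
          · exact h.trans hkj
          · exact h.2
        · have : j = j0 := Fin.ext (by
            change j.1 = m
            rw [Fin.lt_def, Fin.lt_def] at hj hjj
            omega)
          rw [this]; exact g2
      · refine ⟨M, h1, fun j hj => h2 j ?_⟩
        rw [Fin.lt_def, Fin.lt_def] at hj ⊢
        omega
  obtain ⟨M, h1, h2⟩ := key n
  refine ⟨M, fun h => h1 (by rw [h]; exact V.zero_mem), fun j hj => h2 j ?_⟩
  rcases lt_or_gt_of_ne hj with h | h
  · exact Or.inl h
  · exact Or.inr ⟨h, j.2⟩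

end Constr2

section Main

variable (K : Type u) [Field K] [Algebra K A]

theorem coef_low [FiniteDimensional K A] {n : ℕ} {E : Fin n → ModuleCat.{u} A}
    [hf : ∀ i, Module.Finite A (E i)] (hE : EF E) {W : Type u} [AddCommGroup W] [Module A W]
    [Module.Finite A W] {a : Fin n → ℚ}
    (h : ∑ i, a i • wc K A (E i) = wc K A W) (s : ℕ)
    (hs : ∀ j : Fin n, j.1 < s → chi K A W (E j) = 0) : ∀ j : Fin n, j.1 < s → a j = 0 := by
  have : ∀ m : ℕ, ∀ j : Fin n, j.1 < s → j.1 < m → a j = 0 := by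
    intro m
    induction m with
    | zero => intro j _ hj; omega
    | succ m ih =>
      intro j hjs hj
      have h1 := coef_snd K (X := E j) h
      rw [hs j hjs, Finset.sum_eq_single j] at h1
      · have := chi_self_pos K hE j
        rcases mul_eq_zero.1 h1.symm with h | h
        · exact h
        · have h' : chi K A (E j) (E j) = 0 := by exact_mod_cast h
          omega
      · intro i _ hij
        rcases lt_or_gt_of_ne hij with h | h
        · have : i.1 < j.1 := h
          rw [ih i (by omega) (by omega), zero_mul]
        · rw [chi_Pp K (hE.perp j i h)]; simp
      · simp
  intro j hj
  exact this n j hj j.2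

theorem coef_high [FiniteDimensional K A] {n : ℕ} {E : Fin n → ModuleCat.{u} A}
    [hf : ∀ i, Module.Finite A (E i)] (hE : EF E) {W : Type u} [AddCommGroup W] [Module A W]
    [Module.Finite A W] {a : Fin n → ℚ}
    (h : ∑ i, a i • wc K A (E i) = wc K A W) (k : Fin n)
    (hs : ∀ j : Fin n, k < j → chi K A (E j) W = 0) : ∀ j : Fin n, k < j → a j = 0 := by
  have : ∀ m : ℕ, ∀ j : Fin n, k < j → n ≤ j.1 + m → a j = 0 := by
    intro m
    induction m with
    | zero => intro j _ hj; have := j.2; omega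
    | succ m ih =>
      intro j hjs hj
      have h1 := coef_fst K (X := E j) h
      rw [hs j hjs, Finset.sum_eq_single j] at h1
      · have := chi_self_pos K hE j
        rcases mul_eq_zero.1 h1.symm with h | h
        · exact h
        · have h' : chi K A (E j) (E j) = 0 := by exact_mod_cast h
          omega
      · intro i _ hij
        rcases lt_or_gt_of_ne hij with h | h
        · rw [chi_Pp K (hE.perp i j h)]; simp
        · have : j.1 < i.1 := h
          rw [ih i (hjs.trans h) (by omega), zero_mul]
      · simp
  intro j hj
  exact this n j hj (by omega)

theorem inSupport_of {S M : ModuleCat.{u} A} (N : Submodule A M) (f : N →ₗ[A] S)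
    (hf : Function.Surjective f) : InSupport S M := by
  refine ⟨(LinearMap.ker f).map N.subtype, N, Submodule.map_subtype_le _ _, ⟨?_⟩⟩
  have hc : Submodule.comap N.subtype ((LinearMap.ker f).map N.subtype) = LinearMap.ker f :=
    Submodule.comap_map_eq_of_injective Subtype.val_injective _
  exact LinearEquiv.toModuleIso
    ((Submodule.quotEquivOfEq _ _ hc).trans (f.quotKerEquivOfSurjective hf))

theorem InSupport.exists {S M : ModuleCat.{u} A} (h : InSupport S M) :
    ∃ (N : Submodule A M) (f : N →ₗ[A] S), Function.Surjective f := by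
  obtain ⟨N₁, N₂, _, ⟨e⟩⟩ := h
  refine ⟨N₂, (e.toLinearEquiv.toLinearMap).comp (Submodule.mkQ _), ?_⟩
  exact e.toLinearEquiv.surjective.comp (Submodule.mkQ_surjective _)

theorem InSupport.hom {S M : ModuleCat.{u} A} (h : InSupport S M) [IsSimpleModule A S] {P : Type u}
    [AddCommGroup P] [Module A P] [Module.Projective A P] (p : P →ₗ[A] S) (hp : p ≠ 0) :
    ∃ g : P →ₗ[A] M, g ≠ 0 := by
  obtain ⟨N, f, hf⟩ := h.exists
  obtain ⟨g, hg⟩ := Module.projective_lifting_property f p hf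
  refine ⟨N.subtype.comp g, fun h0 => hp ?_⟩
  rw [← hg]
  ext x
  have : g x = 0 := Subtype.ext (LinearMap.congr_fun h0 x)
  simp [this]

/-- minimal cover detects supports -/
theorem cover_support [FiniteDimensional K A] (hA : Her A) (S M : ModuleCat.{u} A)
    [IsSimpleModule A S] (P : ModuleCat.{u} A) (p : P →ₗ[A] S) [Module.Finite A P]
    [Module.Projective A P] (hp : Function.Surjective p) (hd : hm K A A P = sd K A S)
    (g : P →ₗ[A] M) (hg : g ≠ 0) : InSupport S M := by
  have hk : ∀ x, g x = 0 → p x = 0 := by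
    by_contra hcon
    push Not at hcon
    obtain ⟨x, hx, hpx⟩ := hcon
    have hs : Function.Surjective (p.comp (LinearMap.ker g).subtype) :=
      LinearMap.surjective_of_ne_zero (fun h => hpx (LinearMap.congr_fun h ⟨x, hx⟩))
    have := subFinite K (LinearMap.ker g)
    have : Module.Projective A (LinearMap.ker g) := hA P inferInstance _
    have h1 := sd_le K _ hs
    have h2 := dim_lt K (LinearMap.ker g) (fun h => hg (LinearMap.ker_eq_top.1 h))
    omega
  obtain ⟨f, hf⟩ := fac g.rangeRestrict g.surjective_rangeRestrict p (fun w hw =>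
    hk w (congrArg Subtype.val hw))
  refine inSupport_of (LinearMap.range g) f fun s => ?_
  obtain ⟨x, rfl⟩ := hp s
  exact ⟨_, hf x⟩

theorem relProj_E0 {n : ℕ} {E : Fin n → ModuleCat.{u} A} (hE : EF E) (k : Fin n) :
    RelProj E k ↔ ∀ (M Y : ModuleCat.{u} A) (π : M →ₗ[A] Y), (∀ j, k < j → Pp A (E j) M) →
      (∀ j, k < j → Pp A (E j) Y) → Function.Surjective π →
      ∀ f : E k →ₗ[A] Y, ∃ g : E k →ₗ[A] M, ∀ x, π (g x) = f x := by
  constructor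
  · rintro ⟨_, h⟩ M Y π hM hY hπ f
    obtain ⟨g, hg⟩ := h M Y (fun j hj => (rperp_iff _ _).2 (hM j hj))
      (fun j hj => (rperp_iff _ _).2 (hY j hj)) (ModuleCat.ofHom π)
      ((ModuleCat.epi_iff_surjective _).2 hπ) (ModuleCat.ofHom f)
    exact ⟨g.hom, fun x => LinearMap.congr_fun (congrArg ModuleCat.Hom.hom hg) x⟩
  · intro h
    refine ⟨fun j hj => (rperp_iff _ _).2 (hE.perp k j hj), ?_⟩
    intro Y Z hY hZ p hp f
    obtain ⟨g, hg⟩ := h Y Z p.hom (fun j hj => (rperp_iff _ _).1 (hY j hj))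
      (fun j hj => (rperp_iff _ _).1 (hZ j hj)) ((ModuleCat.epi_iff_surjective _).1 hp) f.hom
    refine ⟨ModuleCat.ofHom g, ?_⟩
    ext x
    exact hg x

theorem relInj_E0 {n : ℕ} {E : Fin n → ModuleCat.{u} A} (hE : EF E) (k : Fin n) :
    RelInj E k ↔ ∀ (M Y : ModuleCat.{u} A) (i : Y →ₗ[A] M), (∀ j, j < k → Pp A M (E j)) →
      (∀ j, j < k → Pp A Y (E j)) → Function.Injective i →
      ∀ f : Y →ₗ[A] E k, ∃ g : M →ₗ[A] E k, ∀ x, g (i x) = f x := by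
  constructor
  · rintro ⟨_, h⟩ M Y i hM hY hi f
    obtain ⟨g, hg⟩ := h Y M (fun j hj => (lperp_iff _ _).2 (hY j hj))
      (fun j hj => (lperp_iff _ _).2 (hM j hj)) (ModuleCat.ofHom i)
      ((ModuleCat.mono_iff_injective _).2 hi) (ModuleCat.ofHom f)
    exact ⟨g.hom, fun x => LinearMap.congr_fun (congrArg ModuleCat.Hom.hom hg) x⟩
  · intro h
    refine ⟨fun j hj => (lperp_iff _ _).2 (hE.perp j k hj), ?_⟩
    intro Y Z hY hZ p hp f
    obtain ⟨g, hg⟩ := h Z Y p.hom (fun j hj => (lperp_iff _ _).1 (hZ j hj))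
      (fun j hj => (lperp_iff _ _).1 (hY j hj)) ((ModuleCat.mono_iff_injective _).1 hp) f.hom
    refine ⟨ModuleCat.ofHom g, ?_⟩
    ext x
    exact hg x

end Main

section Final

variable (K : Type u) [Field K] [Algebra K A]

theorem fwd [FiniteDimensional K A] (hA : Her A) {n : ℕ} {E : Fin n → ModuleCat.{u} A}
    (hC : CompleteES E) (k : Fin n) (h1 : RelProj E k) (h2 : RelInj E k) :
    ∃ S : ModuleCat.{u} A, IsSimpleModule A S ∧ InSupport S (E k) ∧
        ∀ j : Fin n, j ≠ k → ¬ InSupport S (E j) := by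
  have hE := (EF_iff E).1 hC.1
  have hf := hE.fin
  rw [relProj_E0 hE] at h1
  rw [relInj_E0 hE] at h2
  obtain ⟨⟨Q, hQf⟩, hQ0, hQ⟩ := MQ K hA hE k
  change ∀ j, j ≠ k → Pp A Q (E j) at hQ
  change wc K A Q ≠ 0 at hQ0
  have hQk : E0 A Q (E k) := by
    refine E0.of_split fun W _ _ i p hi hp hip => ?_
    exact h2 (ModuleCat.of A W) (E k) i
      (fun j hj => (hE.perp j k hj).ext_first (hQ j hj.ne) i p hi hp hip)
      (fun j hj => hE.perp j k hj) hi LinearMap.id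
  have hg : ∃ g : Q →ₗ[A] E k, g ≠ 0 := by
    by_contra hcon
    push Not at hcon
    obtain ⟨a, ha⟩ := wc_span K hA hC Q
    have := coef_low K hE ha n (fun j _ => by
      by_cases hj : j = k
      · subst hj
        exact chi_Pp K ⟨hcon, hQk⟩
      · exact chi_Pp K (hQ j hj))
    apply hQ0
    rw [← ha]
    exact Finset.sum_eq_zero fun j _ => by rw [this j j.2, zero_smul]
  obtain ⟨g, hg⟩ := hg
  obtain ⟨r, p, M, π, hM, hπ, _, hM3, hM4⟩ := MP K hA hE k
  obtain ⟨σ, hσ⟩ := h1 M (E k) π hM3 (fun j hj => hE.perp k j hj) hπ LinearMap.id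
  obtain ⟨a, ha⟩ := hM4 Q (fun j hj => hQ j hj.ne') (σ.comp g)
  have ha' : ∀ x, g x = p (a x) := fun x => by
    rw [← ha, LinearMap.comp_apply, hσ]; rfl
  let I := LinearMap.range a
  have hI : Module.Projective A I := hA _ inferInstance _
  have hIj : ∀ j, j ≠ k → ∀ f : I →ₗ[A] E j, f = 0 := by
    intro j hj f
    refine LinearMap.ext ?_
    rintro ⟨_, x, rfl⟩
    exact LinearMap.congr_fun ((hQ j hj).1 (f.comp a.rangeRestrict)) x
  let b : I →ₗ[A] E k := p.comp I.subtype
  have hb : b ≠ 0 := fun h => hg (LinearMap.ext fun x => by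
    rw [ha']
    exact LinearMap.congr_fun h ⟨a x, x, rfl⟩)
  have := noeth K A
  have hnt : Nontrivial (LinearMap.range b) := by
    rw [Submodule.nontrivial_iff_ne_bot]
    exact fun h => hb (LinearMap.range_eq_bot.1 h)
  obtain ⟨U, hU⟩ := IsCoatomic.exists_coatom (Submodule A (LinearMap.range b))
  have hS : IsSimpleModule A (LinearMap.range b ⧸ U) := isSimpleModule_iff_isCoatom.2 hU
  refine ⟨ModuleCat.of A (LinearMap.range b ⧸ U), hS,
    inSupport_of (LinearMap.range b) U.mkQ U.mkQ_surjective, fun j hj hs => ?_⟩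
  have hne : U.mkQ.comp b.rangeRestrict ≠ 0 := by
    intro h
    have := IsSimpleModule.nontrivial A (LinearMap.range b ⧸ U)
    obtain ⟨s, hs⟩ := exists_ne (0 : LinearMap.range b ⧸ U)
    obtain ⟨x, rfl⟩ := (U.mkQ_surjective.comp b.surjective_rangeRestrict) s
    exact hs (LinearMap.congr_fun h x)
  have : IsSimpleModule A (ModuleCat.of A (LinearMap.range b ⧸ U)) := hS
  obtain ⟨f, hf⟩ := hs.hom (P := I) (U.mkQ.comp b.rangeRestrict) hne
  exact hf (hIj j hj f)

theorem bwd [FiniteDimensional K A] (hA : Her A) {n : ℕ} {E : Fin n → ModuleCat.{u} A}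
    (hC : CompleteES E) (k : Fin n) (S : ModuleCat.{u} A) (hS : IsSimpleModule A S)
    (hSk : InSupport S (E k)) (hSj : ∀ j : Fin n, j ≠ k → ¬ InSupport S (E j)) :
    RelProj E k ∧ RelInj E k := by
  have hE := (EF_iff E).1 hC.1
  have hf := hE.fin
  obtain ⟨P, p, hP, hP', hp, hd⟩ := mincover (A := A) K S
  have hPj : ∀ j, j ≠ k → ∀ f : P →ₗ[A] E j, f = 0 := by
    intro j hj f
    by_contra hf
    exact hSj j hj (cover_support K hA S (E j) P p hp hd f hf)
  have hp0 : p ≠ 0 := fun h => by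
    have := IsSimpleModule.nontrivial A S
    obtain ⟨s, hs⟩ := exists_ne (0 : S)
    obtain ⟨x, rfl⟩ := hp s
    exact hs (LinearMap.congr_fun h x)
  obtain ⟨u, hu⟩ := hSk.hom p hp0
  have hPk : 0 < chi K A P (E k) := by
    rw [chi_ext K E0.proj]
    exact_mod_cast hm_pos K u hu
  have hkk := chi_self_pos K hE k
  have hpos : ∀ (M : ModuleCat.{u} A) [Module.Finite A M] (v : P →ₗ[A] M) (_ : v ≠ 0)
      (a : Fin n → ℚ) (_ : ∑ i, a i • wc K A (E i) = wc K A M), 0 < a k := by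
    intro M _ v hv a ha
    have h1 := coef_fst K (X := P) ha
    rw [Finset.sum_eq_single k] at h1
    · have h2 : 0 < chi K A P M := by
        rw [chi_ext K E0.proj]
        exact_mod_cast hm_pos K v hv
      have h2' : (0 : ℚ) < chi K A P M := by exact_mod_cast h2
      have h3 : (0 : ℚ) < chi K A P (E k) := by exact_mod_cast hPk
      rw [h1] at h2'
      exact (mul_pos_iff_of_pos_right h3).1 h2'
    · intro j _ hj
      rw [chi_Pp K ⟨hPj j hj, E0.proj⟩]; simp
    · simp
  constructor
  · obtain ⟨r, _, M, π, hM, hπ, hM2, hM3, _⟩ := MP K hA hE k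
    obtain ⟨a, ha⟩ := wc_span K hA hC M
    obtain ⟨v, hv⟩ := Module.projective_lifting_property π u hπ
    have hak := hpos M v (fun h => hu (by rw [← hv, h, LinearMap.comp_zero])) a ha
    have hz := coef_high K hE ha k (fun j hj => chi_Pp K (hM3 j hj))
    have h1 := coef_fst K (X := E k) ha
    rw [Finset.sum_eq_single k] at h1
    rotate_left
    · intro j _ hj
      rcases lt_or_gt_of_ne hj with h | h
      · rw [chi_Pp K (hE.perp j k h)]; simp
      · rw [hz j h, zero_mul]
    · simp
    have hfx : ∃ f : E k →ₗ[A] M, f ≠ 0 := by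
      by_contra hcon
      push Not at hcon
      have h2 := chi_le (A := A) K (X := E k) (Y := M)
      rw [hm_zero K hcon] at h2
      have h3 : (chi K A (E k) M : ℚ) ≤ 0 := by exact_mod_cast h2
      have h4 : (0 : ℚ) < chi K A (E k) (E k) := by exact_mod_cast hkk
      have h5 := mul_pos hak h4
      linarith
    obtain ⟨f, hf0⟩ := hfx
    have hI : E0 A (LinearMap.range f) (LinearMap.ker f) :=
      (hM2 _ (fun j hj => Pp.ker_second (hE.perp k j hj) (hM3 j hj) f)).sub_first hA
        (LinearMap.range f).subtype Subtype.val_injective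
    obtain ⟨s, hs⟩ := hI.lift (LinearMap.ker f).subtype f.rangeRestrict Subtype.val_injective
      f.surjective_rangeRestrict (exact_range f) LinearMap.id
    have hs0 : s.comp f.rangeRestrict ≠ 0 := by
      intro h
      apply hf0
      refine LinearMap.ext fun x => ?_
      have h1 := hs (f.rangeRestrict x)
      have h2 : s (f.rangeRestrict x) = 0 := LinearMap.congr_fun h x
      rw [h2, map_zero] at h1
      exact (congrArg Subtype.val h1).symm
    have hinj : Function.Injective f := by
      intro x y hxy
      apply (hE.brick k _ hs0).1
      have : f.rangeRestrict x = f.rangeRestrict y := Subtype.ext hxy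
      rw [LinearMap.comp_apply, LinearMap.comp_apply, this]
    rw [relProj_E0 hE]
    intro N Y q hN hY hq φ
    exact ((hM2 (LinearMap.ker q) (fun j hj => Pp.ker_second (hN j hj) (hY j hj) q)).sub_first hA
      f hinj).lift (LinearMap.ker q).subtype q Subtype.val_injective hq (exact_ker q) φ
  · obtain ⟨M, ι, hM, hι, hM2, hM3⟩ := MI K hA hE k
    obtain ⟨a, ha⟩ := wc_span K hA hC M
    have hak := hpos M (ι.comp u) (fun h => hu (LinearMap.ext fun x => hι (by
      rw [LinearMap.zero_apply, map_zero]
      exact LinearMap.congr_fun h x))) a ha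
    have hz := coef_low K hE ha k.1 (fun j hj => chi_Pp K (hM3 j hj))
    have h1 := coef_snd K (X := E k) ha
    rw [Finset.sum_eq_single k] at h1
    rotate_left
    · intro j _ hj
      rcases lt_or_gt_of_ne hj with h | h
      · rw [hz j h, zero_mul]
      · rw [chi_Pp K (hE.perp k j h)]; simp
    · simp
    have hfx : ∃ f : M →ₗ[A] E k, f ≠ 0 := by
      by_contra hcon
      push Not at hcon
      have h2 := chi_le (A := A) K (X := M) (Y := E k)
      rw [hm_zero K hcon] at h2
      have h3 : (chi K A M (E k) : ℚ) ≤ 0 := by exact_mod_cast h2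
      have h4 : (0 : ℚ) < chi K A (E k) (E k) := by exact_mod_cast hkk
      have h5 := mul_pos hak h4
      linarith
    obtain ⟨f, hf0⟩ := hfx
    have hI : E0 A (E k ⧸ LinearMap.range f) (LinearMap.range f) :=
      (hM2 _ (fun j hj => Pp.coker_first hA (hM3 j hj) (hE.perp j k hj) f)).quot_second hA
        f.rangeRestrict f.surjective_rangeRestrict
    obtain ⟨s, hs⟩ := hI _ _ (LinearMap.range f).subtype (LinearMap.range f).mkQ
      Subtype.val_injective (Submodule.mkQ_surjective _) (exact_sub _) LinearMap.id
    have hs0 : (LinearMap.range f).subtype.comp s ≠ 0 := by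
      intro h
      apply hf0
      refine LinearMap.ext fun x => ?_
      have h1 := hs (f.rangeRestrict x)
      have h2 := LinearMap.congr_fun h (f x)
      have h3 : ((s (f x) : LinearMap.range f) : E k) = f x := congrArg Subtype.val h1
      rw [← h3]
      exact h2
    have hsurj : Function.Surjective f := by
      intro y
      obtain ⟨x, rfl⟩ := (hE.brick k _ hs0).2 y
      exact (s x).2
    rw [relInj_E0 hE]
    intro N Y i hN hY hi φ
    exact ((hM2 (N ⧸ LinearMap.range i) (fun j hj =>
      Pp.coker_first hA (hY j hj) (hN j hj) i)).quot_second hA f hsurj) _ _ i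
      (LinearMap.range i).mkQ hi (Submodule.mkQ_surjective _) (LinearMap.exact_map_mkQ_range i) φ

end Final

/-- In a complete exceptional sequence, `Eₖ` is both relatively
projective and relatively injective if and only if its support is not contained in the
union of the supports of the other terms, i.e., some simple composition factor of `Eₖ`
is not a composition factor of any `E_j`, `j ≠ k`. -/
theorem stmt9 {K : Type u} [Field K] {A : Type u} [Ring A] [Algebra K A]
    [FiniteDimensional K A] (hA : Hereditary A)
    {n : ℕ} (E : Fin n → ModuleCat.{u} A) (hE : CompleteES E) (k : Fin n) :
    (RelProj E k ∧ RelInj E k) ↔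
      ∃ S : ModuleCat.{u} A, IsSimpleModule A S ∧ InSupport S (E k) ∧
        ∀ j : Fin n, j ≠ k → ¬ InSupport S (E j) := by
  constructor
  · rintro ⟨h1, h2⟩
    exact fwd K hA.her hE k h1 h2
  · rintro ⟨S, h1, h2, h3⟩
    exact bwd K hA.her hE k S h1 h2 h3

end ExcSeq
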